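/- For every κ ∈ ℝ there exists N₀ such that for all N ≥ N₀ the following holds for every ε with (log log N)^{-1/10} ≤ ε < 1/2: if p, p' ∈ (0,1) satisfy ℙ_p(⋂_{x : ω_x = 1} H(x) = ∅) = ε and ℙ_{p'}(⋂_{x : ω_x = 1} H(x) = ∅) = 1 − ε, then p' ≤ p · (1 + (log log N)^{-1/10}). -/

import Mathlib

open scoped Classical

noncomputable section

/-- A point of the discrete cube `Σ_N = {-1,1}^N`, encoded by booleans
(`true ↦ +1`, `false ↦ -1`). -/
abbrev Cube (N : ℕ) := Fin N → Bool

/-- The `±1` value encoded by a boolean. -/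
def pmVal (b : Bool) : ℝ := if b then 1 else -1

/-- The inner product `x · y = ∑ i x^i y^i` on `Σ_N`. -/
def cubeDot {N : ℕ} (x y : Cube N) : ℝ := ∑ i, pmVal (x i) * pmVal (y i)

/-- The half cube `H(x) := {y ∈ Σ_N : x · y ≥ κ √N}`. -/
def halfCube {N : ℕ} (κ : ℝ) (x : Cube N) : Set (Cube N) :=
  {y | cubeDot x y ≥ κ * Real.sqrt N}

/-- Bernoulli(p) product weight of a configuration `ω : Σ_N → {0,1}`. -/
def bWeight {N : ℕ} (p : ℝ) (ω : Cube N → Bool) : ℝ :=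
  p ^ (Finset.univ.filter fun x => ω x = true).card *
    (1 - p) ^ (Finset.univ.filter fun x => ω x = false).card

/-- The product Bernoulli measure `ℙ_p` of an event `E ⊆ {0,1}^{Σ_N}`. -/
def bernoulliP {N : ℕ} (p : ℝ) (E : Set (Cube N → Bool)) : ℝ :=
  ∑ ω : Cube N → Bool, if ω ∈ E then bWeight p ω else 0

/-- The event that `⋂_{x : ω_x = 1} H(x) = ∅` (an intersection over an empty
index set being all of `Σ_N`). -/
def emptyInter {N : ℕ} (κ : ℝ) : Set (Cube N → Bool) :=
  {ω | (⋂ x ∈ {x : Cube N | ω x = true}, halfCube κ x) = (∅ : Set (Cube N))}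


/-! ### Bernoulli expectations on a finite product -/

def wt (p : ℝ) (b : Bool) : ℝ := if b then p else 1 - p

lemma wt_nonneg {p : ℝ} (h0 : 0 ≤ p) (h1 : p ≤ 1) (b : Bool) : 0 ≤ wt p b := by
  unfold wt; split_ifs <;> linarith

lemma sum_wt (p : ℝ) : ∑ b : Bool, wt p b = 1 := by
  simp [wt]

def bE {X : Type*} [Fintype X] [DecidableEq X] (p : ℝ) (F : (X → Bool) → ℝ) : ℝ :=
  ∑ ω : X → Bool, (∏ x, wt p (ω x)) * F ω

set_option linter.unusedSectionVars false

section bEsec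

variable {X : Type*} [Fintype X] [DecidableEq X]

lemma sum_prod_fun {ι : Type*} [Fintype ι] (f : X → ι → ℝ) :
    ∑ ω : X → ι, ∏ x, f x (ω x) = ∏ x, ∑ b, f x b := by
  rw [Finset.prod_univ_sum]; simp

lemma bE_prod (p : ℝ) (f : X → Bool → ℝ) :
    bE p (fun ω => ∏ x, f x (ω x)) = ∏ x, (p * f x true + (1 - p) * f x false) := by
  unfold bE
  simp_rw [← Finset.prod_mul_distrib]
  rw [sum_prod_fun (fun x b => wt p b * f x b)]
  simp [wt]

lemma bE_const (p c : ℝ) : bE p (fun _ : X → Bool => c) = c := by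
  unfold bE
  rw [← Finset.sum_mul, sum_prod_fun (fun _ b => wt p b)]
  simp [wt]

lemma bE_add (p : ℝ) (F G : (X → Bool) → ℝ) :
    bE p (fun ω => F ω + G ω) = bE p F + bE p G := by
  unfold bE; simp [mul_add, Finset.sum_add_distrib]

lemma bE_sub (p : ℝ) (F G : (X → Bool) → ℝ) :
    bE p (fun ω => F ω - G ω) = bE p F - bE p G := by
  unfold bE; simp [mul_sub, Finset.sum_sub_distrib]

lemma bE_mul_left (p c : ℝ) (F : (X → Bool) → ℝ) :
    bE p (fun ω => c * F ω) = c * bE p F := by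
  unfold bE; rw [Finset.mul_sum]; congr 1; ext; ring

lemma bE_sum {ι : Type*} (s : Finset ι) (p : ℝ) (F : ι → (X → Bool) → ℝ) :
    bE p (fun ω => ∑ i ∈ s, F i ω) = ∑ i ∈ s, bE p (F i) := by
  unfold bE; simp_rw [Finset.mul_sum]; rw [Finset.sum_comm]

lemma bE_mono {p : ℝ} (h0 : 0 ≤ p) (h1 : p ≤ 1) {F G : (X → Bool) → ℝ}
    (h : ∀ ω, F ω ≤ G ω) : bE p F ≤ bE p G := by
  unfold bE
  exact Finset.sum_le_sum fun ω _ => mul_le_mul_of_nonneg_left (h ω)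
    (Finset.prod_nonneg fun x _ => wt_nonneg h0 h1 _)

lemma bE_nonneg {p : ℝ} (h0 : 0 ≤ p) (h1 : p ≤ 1) {F : (X → Bool) → ℝ}
    (h : ∀ ω, 0 ≤ F ω) : 0 ≤ bE p F := by
  have := bE_mono h0 h1 (F := fun _ => 0) h
  rwa [bE_const] at this

/-- averaging one coordinate -/
def av (p : ℝ) (x : X) (F : (X → Bool) → ℝ) : (X → Bool) → ℝ :=
  fun ω => p * F (Function.update ω x true) + (1 - p) * F (Function.update ω x false)

lemma sum_update (x : X) (G : (X → Bool) → ℝ) :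
    ∑ ω, (G (Function.update ω x true) + G (Function.update ω x false)) = 2 * ∑ ω, G ω := by
  have h : ∀ ω : X → Bool, G (Function.update ω x true) + G (Function.update ω x false)
      = G ω + G (Function.update ω x (!ω x)) := by
    intro ω
    cases h : ω x
    · have : Function.update ω x false = ω := by rw [← h]; simp
      rw [this]; simp [add_comm]
    · have : Function.update ω x true = ω := by rw [← h]; simp
      rw [this]; simp
  simp_rw [h]
  rw [Finset.sum_add_distrib, two_mul]
  congr 1
  have hinv : Function.Involutive (fun ω : X → Bool => Function.update ω x (!ω x)) := by
    intro ω; simp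
  exact Equiv.sum_comp hinv.toPerm G

lemma bE_av (p : ℝ) (x : X) (F : (X → Bool) → ℝ) : bE p (av p x F) = bE p F := by
  unfold bE
  have key : ∀ (ω : X → Bool) (b : Bool), ∏ z, wt p (Function.update ω x b z)
      = wt p b * ∏ z ∈ Finset.univ.erase x, wt p (ω z) := by
    intro ω b
    rw [← Finset.mul_prod_erase _ _ (Finset.mem_univ x)]
    simp only [Function.update_self]
    congr 1
    refine Finset.prod_congr rfl fun z hz => ?_
    rw [Function.update_of_ne (Finset.ne_of_mem_erase hz)]
  have h1 := sum_update x (fun ω => (∏ z, wt p (ω z)) * av p x F ω)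
  have h2 := sum_update x (fun ω => (∏ z, wt p (ω z)) * F ω)
  have : (2 : ℝ) * ∑ ω, (∏ z, wt p (ω z)) * av p x F ω = 2 * ∑ ω, (∏ z, wt p (ω z)) * F ω := by
    rw [← h1, ← h2]
    refine Finset.sum_congr rfl fun ω _ => ?_
    simp only [key, av, Function.update_idem]
    simp only [wt]
    simp
    ring
  linarith

def avl (p : ℝ) : List X → ((X → Bool) → ℝ) → ((X → Bool) → ℝ)
  | [], F => F
  | x :: l, F => avl p l (av p x F)

lemma bE_avl (p : ℝ) (l : List X) (F : (X → Bool) → ℝ) : bE p (avl p l F) = bE p F := by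
  induction l generalizing F with
  | nil => rfl
  | cons x l ih => simp only [avl]; rw [ih, bE_av]

def CoordInv (x : X) (F : (X → Bool) → ℝ) : Prop := ∀ ω b, F (Function.update ω x b) = F ω

lemma inv_av_self (p : ℝ) (x : X) (F : (X → Bool) → ℝ) : CoordInv x (av p x F) := by
  intro ω b; simp [av]

lemma inv_av (p : ℝ) (x z : X) (F : (X → Bool) → ℝ) (h : CoordInv x F) : CoordInv x (av p z F) := by
  by_cases hxz : x = z
  · subst hxz; exact inv_av_self p x F
  · intro ω b
    simp only [av]
    rw [Function.update_comm hxz, Function.update_comm hxz, h, h]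

lemma inv_avl (p : ℝ) (x : X) (l : List X) (F : (X → Bool) → ℝ) (h : CoordInv x F) :
    CoordInv x (avl p l F) := by
  induction l generalizing F with
  | nil => exact h
  | cons z l ih => exact ih _ (inv_av p x z F h)

lemma inv_avl_mem (p : ℝ) (x : X) (l : List X) (F : (X → Bool) → ℝ) (h : x ∈ l) :
    CoordInv x (avl p l F) := by
  induction l generalizing F with
  | nil => simp at h
  | cons z l ih =>
    rcases List.mem_cons.1 h with rfl | h
    · exact inv_avl p x l _ (inv_av_self p x F)
    · exact ih _ h

lemma inv_const (F : (X → Bool) → ℝ) (h : ∀ x, CoordInv x F) (ω ω' : X → Bool) : F ω = F ω' := by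
  have : ∀ s : Finset X, F (fun x => if x ∈ s then ω x else ω' x) = F ω' := by
    intro s
    induction s using Finset.induction_on with
    | empty => simp
    | insert a s ha ih =>
      rw [← ih, ← h a (fun x => if x ∈ s then ω x else ω' x) (ω a)]
      congr 1
      ext x
      by_cases hx : x = a
      · subst hx; simp
      · simp [hx]
  have h2 := this Finset.univ
  simpa using h2

lemma avl_univ (p : ℝ) (F : (X → Bool) → ℝ) (ω : X → Bool) :
    avl p (Finset.univ : Finset X).toList F ω = bE p F := by
  rw [← bE_avl p (Finset.univ : Finset X).toList F]
  have : avl p (Finset.univ : Finset X).toList F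
      = fun _ => avl p (Finset.univ : Finset X).toList F ω := by
    ext ω'
    exact inv_const _ (fun x => inv_avl_mem p x _ F (by simp)) _ _
  rw [this, bE_const]

/-- discrete derivative -/
def dd (x : X) (F : (X → Bool) → ℝ) : (X → Bool) → ℝ :=
  fun ω => F (Function.update ω x false) - F (Function.update ω x true)

lemma dd_av (p : ℝ) (x z : X) (h : x ≠ z) (F : (X → Bool) → ℝ) (ω : X → Bool) :
    dd z (av p x F) ω = av p x (dd z F) ω := by
  simp only [dd, av]
  rw [Function.update_comm h, Function.update_comm h, Function.update_comm h,
    Function.update_comm h]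
  ring

lemma dd_av_self (p : ℝ) (x : X) (F : (X → Bool) → ℝ) (ω : X → Bool) :
    dd x (av p x F) ω = 0 := by
  simp [dd, av]

lemma efron_stein_list {p : ℝ} (h0 : 0 ≤ p) (h1 : p ≤ 1) (l : List X) (F : (X → Bool) → ℝ) :
    bE p (fun ω => F ω ^ 2) - bE p (fun ω => avl p l F ω ^ 2)
      ≤ (l.map fun x => p * (1 - p) * bE p (fun ω => dd x F ω ^ 2)).sum := by
  induction l generalizing F with
  | nil => simp [avl]
  | cons x l ih =>
    simp only [avl, List.map_cons, List.sum_cons]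
    have e1 : bE p (fun ω => F ω ^ 2) - bE p (fun ω => av p x F ω ^ 2)
        = p * (1 - p) * bE p (fun ω => dd x F ω ^ 2) := by
      rw [← bE_av p x (fun ω => F ω ^ 2), ← bE_sub, ← bE_mul_left]
      congr 1; ext ω; simp only [av, dd]; ring
    have e2 := ih (av p x F)
    have e3 : (l.map fun z => p * (1 - p) * bE p (fun ω => dd z (av p x F) ω ^ 2)).sum
        ≤ (l.map fun z => p * (1 - p) * bE p (fun ω => dd z F ω ^ 2)).sum := by
      apply List.sum_le_sum
      intro z _
      apply mul_le_mul_of_nonneg_left _ (mul_nonneg h0 (by linarith))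
      by_cases hxz : x = z
      · subst hxz
        apply bE_mono h0 h1
        intro ω; simp only [dd_av_self]; simpa using sq_nonneg _
      · rw [← bE_av p x (fun ω => dd z F ω ^ 2)]
        apply bE_mono h0 h1
        intro ω; simp only [dd_av p x z hxz]
        simp only [av]
        set a := dd z F (Function.update ω x true)
        set b := dd z F (Function.update ω x false)
        have : 0 ≤ p * (1 - p) * (a - b) ^ 2 :=
          mul_nonneg (mul_nonneg h0 (by linarith)) (sq_nonneg _)
        nlinarith
    linarith

lemma efron_stein {p : ℝ} (h0 : 0 ≤ p) (h1 : p ≤ 1) (F : (X → Bool) → ℝ) :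
    bE p (fun ω => F ω ^ 2) - bE p F ^ 2
      ≤ ∑ x, p * (1 - p) * bE p (fun ω => dd x F ω ^ 2) := by
  have h := efron_stein_list h0 h1 (Finset.univ : Finset X).toList F
  simp_rw [avl_univ, bE_const] at h
  rw [Finset.sum_map_toList] at h
  exact h

lemma mgf_list {c : ℝ} (l : List X) (F : (X → Bool) → ℝ)
    (hF : ∀ x ω, |dd x F ω| ≤ 2 * c) :
    bE (1/2) (fun ω => Real.exp (F ω))
      ≤ Real.exp (l.length * (c ^ 2 / 2)) * bE (1/2) (fun ω => Real.exp (avl (1/2) l F ω)) := by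
  induction l generalizing F with
  | nil => simp [avl]
  | cons x l ih =>
    have hstep : bE (1/2) (fun ω => Real.exp (F ω))
        ≤ Real.exp (c ^ 2 / 2) * bE (1/2) (fun ω => Real.exp (av (1/2) x F ω)) := by
      rw [← bE_av (1/2) x, ← bE_mul_left]
      apply bE_mono (by norm_num) (by norm_num)
      intro ω
      have h := hF x ω
      simp only [av]
      simp only [dd] at h
      set a := F (Function.update ω x true)
      set b := F (Function.update ω x false)
      have hc := Real.cosh_le_exp_half_sq ((b - a) / 2)
      have h2 : ((b - a) / 2) ^ 2 / 2 ≤ c ^ 2 / 2 := by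
        have : |(b - a) / 2| ≤ c := by rw [abs_div, abs_two]; linarith
        have := sq_le_sq' (abs_le.1 this).1 (abs_le.1 this).2
        linarith
      have h3 : (1/2 : ℝ) * Real.exp a + (1 - 1/2) * Real.exp b
          = Real.cosh ((b - a) / 2) * Real.exp (1/2 * a + (1 - 1/2) * b) := by
        have e1 : Real.exp a = Real.exp (-((b - a) / 2)) * Real.exp (1/2 * a + (1 - 1/2) * b) := by
          rw [← Real.exp_add]; ring_nf
        have e2 : Real.exp b = Real.exp ((b - a) / 2) * Real.exp (1/2 * a + (1 - 1/2) * b) := by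
          rw [← Real.exp_add]; ring_nf
        rw [Real.cosh_eq, e1, e2]
        ring
      rw [h3]
      exact mul_le_mul_of_nonneg_right (hc.trans (Real.exp_le_exp.2 h2)) (Real.exp_pos _).le
    have hi := ih (av (1/2) x F) (by
      intro z ω
      by_cases hxz : x = z
      · subst hxz; rw [dd_av_self, abs_zero]
        exact (abs_nonneg _).trans (hF x ω)
      · rw [dd_av _ x z hxz]
        have h1 := abs_le.1 (hF z (Function.update ω x true))
        have h2 := abs_le.1 (hF z (Function.update ω x false))
        simp only [av]
        rw [abs_le]; constructor <;> linarith)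
    simp only [avl, List.length_cons]
    push_cast
    rw [add_mul, Real.exp_add, one_mul]
    calc _ ≤ _ := hstep
      _ ≤ Real.exp (c ^ 2 / 2) * _ := mul_le_mul_of_nonneg_left hi (Real.exp_pos _).le
      _ = _ := by ring

lemma mgf_bound {c : ℝ} (F : (X → Bool) → ℝ) (hF : ∀ x ω, |dd x F ω| ≤ 2 * c) :
    bE (1/2) (fun ω => Real.exp (F ω))
      ≤ Real.exp (Fintype.card X * (c ^ 2 / 2) + bE (1/2) F) := by
  have h := mgf_list (Finset.univ : Finset X).toList F hF
  simp_rw [avl_univ, bE_const] at h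
  rw [Real.exp_add]
  simpa using h

/-- lower tail -/
lemma lower_tail {c s : ℝ} (hX : 0 < (Fintype.card X : ℝ)) (hc : 0 < c) (hs : 0 ≤ s)
    (F : (X → Bool) → ℝ)
    (hF : ∀ x ω, |dd x F ω| ≤ 2 * c) :
    bE (1/2) (fun ω => if F ω < bE (1/2) F - s then 1 else 0)
      ≤ Real.exp (- (s ^ 2 / (2 * Fintype.card X * c ^ 2))) := by
  set n : ℝ := (Fintype.card X : ℝ)
  set t := s / (n * c ^ 2) with ht
  have ht0 : 0 ≤ t := by positivity
  have h := mgf_bound (c := t * c) (fun ω => -t * F ω) (by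
    intro x ω
    have := hF x ω
    have e : dd x (fun ω => -t * F ω) ω = -t * dd x F ω := by simp only [dd]; ring
    rw [e, abs_mul, abs_neg, abs_of_nonneg ht0]
    nlinarith)
  rw [bE_mul_left] at h
  have h2 : bE (1/2) (fun ω => if F ω < bE (1/2) F - s then (1:ℝ) else 0)
      ≤ bE (1/2) (fun ω => Real.exp (t * (bE (1/2) F - s)) * Real.exp (-t * F ω)) := by
    apply bE_mono (by norm_num) (by norm_num)
    intro ω
    rw [← Real.exp_add]
    split_ifs with hω
    · apply Real.one_le_exp
      nlinarith
    · positivity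
  rw [bE_mul_left] at h2
  refine h2.trans ((mul_le_mul_of_nonneg_left h (Real.exp_pos _).le).trans ?_)
  rw [← Real.exp_add]
  apply Real.exp_le_exp.2
  apply le_of_eq
  rw [ht]
  field_simp
  ring

/-- Russo-type derivative -/
lemma bE_hasDerivAt {p : ℝ} (h0 : 0 < p) (h1 : p < 1) (F : (X → Bool) → ℝ) :
    HasDerivAt (fun q => bE q F) (- ∑ x, bE p (dd x F)) p := by
  have hw : ∀ b : Bool, HasDerivAt (fun q => wt q b) (if b then 1 else -1) p := by
    intro b
    cases b
    · simpa [wt] using (hasDerivAt_id p).const_sub 1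
    · simpa [wt] using (hasDerivAt_id' p)
  have hd : HasDerivAt (fun q => bE q F)
      (∑ ω : X → Bool, (∑ x, (∏ z ∈ Finset.univ.erase x, wt p (ω z)) • (if ω x then (1:ℝ) else -1))
        * F ω) p := by
    unfold bE
    apply HasDerivAt.fun_sum
    intro ω _
    apply HasDerivAt.mul_const
    exact HasDerivAt.fun_finsetProd fun x _ => hw (ω x)
  convert hd using 1
  rw [← Finset.sum_neg_distrib]
  simp_rw [Finset.sum_mul]
  rw [Finset.sum_comm]
  refine Finset.sum_congr rfl fun x _ => ?_
  have e : bE p (fun ω => F ω * ((if ω x then (1:ℝ) else -1) / wt p (ω x)))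
      = - bE p (dd x F) := by
    rw [← bE_av p x, ← neg_one_mul (bE p (dd x F)), ← bE_mul_left]
    congr 1; ext ω
    have : 1 - p ≠ 0 := by linarith
    simp only [av, dd, wt, Function.update_self]
    simp
    field_simp
    ring
  rw [← e]
  unfold bE
  refine Finset.sum_congr rfl fun ω _ => ?_
  have : wt p (ω x) ≠ 0 := by
    unfold wt; split_ifs <;> linarith
  rw [← Finset.mul_prod_erase _ _ (Finset.mem_univ x), smul_eq_mul]
  field_simp

lemma bE_continuous (F : (X → Bool) → ℝ) : Continuous (fun q => bE q F) := by
  unfold bE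
  have : ∀ b : Bool, Continuous (fun q => wt q b) := by
    intro b; cases b <;> simp [wt] <;> fun_prop
  fun_prop

lemma bE_zero (F : (X → Bool) → ℝ) : bE 0 F = F (fun _ => false) := by
  unfold bE
  rw [Finset.sum_eq_single (fun _ => false)]
  · simp [wt]
  · intro ω _ hω
    have : ∃ x, ω x = true := by
      by_contra hcon
      push Not at hcon
      exact hω (by ext x; simpa using hcon x)
    obtain ⟨x, hx⟩ := this
    rw [Finset.prod_eq_zero (Finset.mem_univ x) (by simp [wt, hx]), zero_mul]
  · simp

lemma bE_dd_restrict (p : ℝ) (x : X) (F : (X → Bool) → ℝ) (φ : ℝ → ℝ) :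
    bE p (fun ω => if ω x = false then φ (dd x F ω) else 0) = (1 - p) * bE p (fun ω => φ (dd x F ω)) := by
  rw [← bE_av p x, ← bE_mul_left]
  congr 1; ext ω
  simp [av, dd]

/-- sprinkling -/
lemma bE_sprinkle {p s q : ℝ} (h : 1 - q = (1 - p) * (1 - s)) (F : (X → Bool) → ℝ) :
    bE q F = bE p (fun ω => bE s (fun σ => F (fun x => ω x || σ x))) := by
  have hq : ∀ c : Bool, wt q c = ∑ ab : Bool × Bool,
      (wt p ab.1 * wt s ab.2 * if (ab.1 || ab.2) = c then 1 else 0) := by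
    intro c
    rw [Fintype.sum_prod_type]
    cases c <;> simp [wt] <;> linarith
  have hL : bE q F = ∑ τ : X → Bool, (∑ ab : X → Bool × Bool,
      ∏ x, (wt p (ab x).1 * wt s (ab x).2 * if ((ab x).1 || (ab x).2) = τ x then 1 else 0)) * F τ := by
    unfold bE
    refine Finset.sum_congr rfl fun τ _ => ?_
    rw [sum_prod_fun (fun x (ab : Bool × Bool) =>
      wt p ab.1 * wt s ab.2 * if (ab.1 || ab.2) = τ x then 1 else 0)]
    simp_rw [← hq]
  have hR : bE p (fun ω => bE s (fun σ => F (fun x => ω x || σ x)))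
      = ∑ ab : X → Bool × Bool, (∏ x, wt p (ab x).1 * wt s (ab x).2)
        * F (fun x => (ab x).1 || (ab x).2) := by
    unfold bE
    simp_rw [Finset.mul_sum]
    rw [← Fintype.sum_prod_type' (f := fun (ω σ : X → Bool) => (∏ x, wt p (ω x)) *
      ((∏ x, wt s (σ x)) * F (fun x => ω x || σ x)))]
    refine Fintype.sum_equiv (Equiv.arrowProdEquivProdArrow X (fun _ => Bool) (fun _ => Bool)).symm _ _ ?_
    rintro ⟨ω, σ⟩
    simp [Finset.prod_mul_distrib, Equiv.arrowProdEquivProdArrow, mul_assoc]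
  rw [hL, hR]
  simp_rw [Finset.sum_mul]
  rw [Finset.sum_comm]
  refine Finset.sum_congr rfl fun ab _ => ?_
  rw [Finset.sum_eq_single (fun x => (ab x).1 || (ab x).2)]
  · simp
  · intro τ _ hτ
    have : ∃ x, ((ab x).1 || (ab x).2) ≠ τ x := by
      by_contra hcon
      push Not at hcon
      exact hτ (by ext x; simp [hcon x])
    obtain ⟨x, hx⟩ := this
    rw [Finset.prod_eq_zero (Finset.mem_univ x) (by simp [hx]), zero_mul]
  · simp

end bEsec

/-! ### Adding one constraint -/

lemma pmVal_true : pmVal true = 1 := by simp [pmVal]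
lemma pmVal_false : pmVal false = -1 := by simp [pmVal]
lemma abs_pmVal (b : Bool) : |pmVal b| = 1 := by cases b <;> simp [pmVal]
lemma pm_mul_le (a b : Bool) : pmVal a * pmVal b ≤ 1 := by
  cases a <;> cases b <;> norm_num [pmVal]
lemma pm_mul_ge (a b : Bool) : -1 ≤ pmVal a * pmVal b := by
  cases a <;> cases b <;> norm_num [pmVal]

lemma le_of_sq_le_sq' {a b : ℝ} (h : a ^ 2 ≤ b ^ 2) (hb : 0 ≤ b) : a ≤ b :=
  le_of_abs_le (by simpa [abs_of_nonneg hb] using sq_le_sq.1 h)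

lemma cs_tail {ι : Type*} (S : Finset ι) (f : ι → ℝ) (G : ι → Prop) [DecidablePred G]
    {a B : ℝ} (hB : 0 < B) (hG : ∀ y ∈ S, ¬ G y → f y ≤ a)
    (h1 : (S.card : ℝ) * (Real.exp a + 1) ≤ ∑ y ∈ S, Real.exp (f y))
    (h2 : ∑ y ∈ S, Real.exp (2 * f y) ≤ S.card * B) :
    (S.card : ℝ) / B ≤ ((S.filter G).card : ℝ) := by
  have e1 : ∑ y ∈ S, Real.exp (f y)
      = ∑ y ∈ S.filter G, Real.exp (f y) + ∑ y ∈ S.filter (fun y => ¬ G y), Real.exp (f y) :=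
    (Finset.sum_filter_add_sum_filter_not _ _ _).symm
  have e2 : ∑ y ∈ S.filter (fun y => ¬ G y), Real.exp (f y) ≤ S.card * Real.exp a := by
    calc _ ≤ ∑ y ∈ S.filter (fun y => ¬ G y), Real.exp a := by
          apply Finset.sum_le_sum
          intro y hy
          rw [Finset.mem_filter] at hy
          exact Real.exp_le_exp.2 (hG y hy.1 hy.2)
      _ ≤ _ := by
          rw [Finset.sum_const, nsmul_eq_mul]
          apply mul_le_mul_of_nonneg_right _ (Real.exp_pos _).le
          exact_mod_cast Finset.card_filter_le _ _
  have e3 : (S.card : ℝ) ≤ ∑ y ∈ S.filter G, Real.exp (f y) := by linarith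
  have e4 : (∑ y ∈ S.filter G, Real.exp (f y)) ^ 2
      ≤ (S.filter G).card * ∑ y ∈ S.filter G, Real.exp (f y) ^ 2 := sq_sum_le_card_mul_sum_sq
  have e5 : ∑ y ∈ S.filter G, Real.exp (f y) ^ 2 ≤ S.card * B := by
    refine le_trans ?_ h2
    calc _ = ∑ y ∈ S.filter G, Real.exp (2 * f y) := by
          refine Finset.sum_congr rfl fun y _ => ?_
          rw [sq, ← Real.exp_add, two_mul]
      _ ≤ _ := Finset.sum_le_sum_of_subset_of_nonneg (Finset.filter_subset _ _)
          (fun _ _ _ => (Real.exp_pos _).le)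
  rcases Nat.eq_zero_or_pos S.card with h0 | h0
  · rw [h0]; simp
  have h0' : (0 : ℝ) < S.card := by exact_mod_cast h0
  rw [div_le_iff₀ hB]
  have e6 : (S.card : ℝ) ^ 2 ≤ (S.filter G).card * (S.card * B) := by
    calc (S.card : ℝ) ^ 2 ≤ (∑ y ∈ S.filter G, Real.exp (f y)) ^ 2 :=
          pow_le_pow_left₀ h0'.le e3 2
      _ ≤ _ := e4
      _ ≤ _ := mul_le_mul_of_nonneg_left e5 (Nat.cast_nonneg _)
  nlinarith

lemma gibbs_bound {N : ℕ} (S : Finset (Cube N)) (w : Cube N → ℝ) {δ : ℝ} (hδ : 0 < δ)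
    (hw : ∀ y ∈ S, 0 < w y)
    (hmax : ∀ y ∈ S, w y * Real.exp (δ / 2 * N) ≤ ∑ y ∈ S, w y) :
    δ ^ 2 * N / 16 * ∑ y ∈ S, w y ≤
      ∑ i : Fin N, min (∑ y ∈ S, if y i = true then w y else 0)
        (∑ y ∈ S, if y i = false then w y else 0) := by
  set Z := ∑ y ∈ S, w y with hZ
  set P : Fin N → ℝ := fun i => ∑ y ∈ S, if y i = true then w y else 0 with hP
  set Q : Fin N → ℝ := fun i => ∑ y ∈ S, if y i = false then w y else 0 with hQ
  have hs : ∀ i, ∃ s : Bool, min (P i) (Q i) = ∑ y ∈ S, if y i = s then 0 else w y := by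
    intro i
    rcases le_total (P i) (Q i) with h | h
    · refine ⟨false, ?_⟩
      rw [min_eq_left h, hP]
      refine Finset.sum_congr rfl fun y _ => ?_
      cases y i <;> simp
    · refine ⟨true, ?_⟩
      rw [min_eq_right h, hQ]
      refine Finset.sum_congr rfl fun y _ => ?_
      cases y i <;> simp
  choose s hs using hs
  set d : Cube N → ℝ := fun y => ∑ i, if y i = s i then (0 : ℝ) else 1 with hd
  have hsum : ∑ i : Fin N, min (P i) (Q i) = ∑ y ∈ S, w y * d y := by
    simp_rw [hs, hd, Finset.mul_sum]
    rw [Finset.sum_comm]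
    refine Finset.sum_congr rfl fun y _ => Finset.sum_congr rfl fun i _ => ?_
    split_ifs <;> simp
  change _ ≤ ∑ i : Fin N, min (P i) (Q i)
  rw [hsum]
  set z := δ / 4 with hz
  have hz0 : 0 < z := by positivity
  set f : Fin N → Bool → ℝ := fun i b => if b = s i then 1 / (1 + z) else z / (1 + z) with hf
  have hf1 : ∑ y : Cube N, ∏ i, f i (y i) = 1 := by
    rw [sum_prod_fun]
    apply Finset.prod_eq_one
    intro i _
    simp only [hf, Fintype.sum_bool]
    have : 1 + z ≠ 0 := by positivity
    cases s i <;> simp <;> field_simp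
    ring
  have hfnn : ∀ i b, 0 ≤ f i b := by
    intro i b; simp only [hf]; split_ifs <;> positivity
  have hfge : ∀ i b, Real.exp (-z - (1 / z) * (if b = s i then 0 else 1)) ≤ f i b := by
    intro i b
    have h1 : Real.exp (-z) ≤ 1 / (1 + z) := by
      rw [Real.exp_neg, ← one_div]
      apply one_div_le_one_div_of_le (by positivity)
      linarith [Real.add_one_le_exp z]
    have h2 : Real.exp (-(1 / z)) ≤ z := by
      rw [Real.exp_neg]
      apply inv_le_of_inv_le₀ hz0
      have := Real.add_one_le_exp (1 / z)
      rw [one_div] at this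
      rw [one_div]
      linarith
    simp only [hf]
    split_ifs
    · simpa using h1
    · have : Real.exp (-z - 1 / z * 1) = Real.exp (-(1/z)) * Real.exp (-z) := by
        rw [← Real.exp_add]; ring_nf
      rw [this]
      calc _ ≤ z * (1 / (1 + z)) := mul_le_mul h2 h1 (Real.exp_pos _).le hz0.le
        _ = _ := by ring
  have hpi : ∀ y, Real.exp (-z * N - (1 / z) * d y) ≤ ∏ i, f i (y i) := by
    intro y
    have : Real.exp (-z * N - (1 / z) * d y)
        = ∏ i, Real.exp (-z - (1 / z) * (if y i = s i then 0 else 1)) := by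
      rw [← Real.exp_sum]
      congr 1
      rw [Finset.sum_sub_distrib, hd, Finset.mul_sum]
      simp [mul_comm]
    rw [this]
    exact Finset.prod_le_prod (fun _ _ => (Real.exp_pos _).le) (fun i _ => hfge i (y i))
  have hZ0 : 0 ≤ Z := Finset.sum_nonneg fun y hy => (hw y hy).le
  have hmain : ∀ y ∈ S, w y * (1 + (δ / 4 * N - 4 / δ * d y)) ≤ (∏ i, f i (y i)) * Z := by
    intro y hy
    have h1 := Real.add_one_le_exp (δ / 4 * N - 4 / δ * d y)
    calc w y * (1 + (δ / 4 * N - 4 / δ * d y))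
        ≤ w y * Real.exp (δ / 4 * N - 4 / δ * d y) :=
          mul_le_mul_of_nonneg_left (by linarith) (hw y hy).le
      _ = Real.exp (-z * N - (1 / z) * d y) * (w y * Real.exp (δ / 2 * N)) := by
          rw [mul_comm (Real.exp _), mul_assoc, ← Real.exp_add]
          congr 2
          rw [hz]; field_simp; ring
      _ ≤ (∏ i, f i (y i)) * Z := by
          apply mul_le_mul (hpi y) (hmax y hy)
          · have := hw y hy; positivity
          · exact Finset.prod_nonneg fun i _ => hfnn _ _
  have h3 : ∑ y ∈ S, w y * (1 + (δ / 4 * N - 4 / δ * d y)) ≤ Z := by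
    calc _ ≤ ∑ y ∈ S, (∏ i, f i (y i)) * Z := Finset.sum_le_sum hmain
      _ = (∑ y ∈ S, (∏ i, f i (y i))) * Z := by rw [Finset.sum_mul]
      _ ≤ (∑ y : Cube N, (∏ i, f i (y i))) * Z := by
          apply mul_le_mul_of_nonneg_right _ hZ0
          exact Finset.sum_le_sum_of_subset_of_nonneg (Finset.subset_univ _)
            (fun y _ _ => Finset.prod_nonneg fun i _ => hfnn i (y i))
      _ = Z := by rw [hf1, one_mul]
  have h4 : ∑ y ∈ S, w y * (1 + (δ / 4 * N - 4 / δ * d y))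
      = Z * (1 + δ / 4 * N) - 4 / δ * ∑ y ∈ S, w y * d y := by
    rw [hZ, Finset.sum_mul, Finset.mul_sum, ← Finset.sum_sub_distrib]
    refine Finset.sum_congr rfl fun y _ => ?_
    ring
  rw [h4] at h3
  have h5 : δ / 4 * N * Z ≤ 4 / δ * ∑ y ∈ S, w y * d y := by linarith
  have h6 := mul_le_mul_of_nonneg_left h5 (by positivity : 0 ≤ δ / 4)
  have h7 : δ / 4 * (4 / δ * ∑ y ∈ S, w y * d y) = ∑ y ∈ S, w y * d y := by
    field_simp
  rw [h7] at h6
  linarith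

def ew {N : ℕ} (θ : ℝ) (A : Finset (Fin N)) (x y : Cube N) : ℝ :=
  Real.exp (θ * ∑ i ∈ A, pmVal (x i) * pmVal (y i))

def Zp {N : ℕ} (θ : ℝ) (A : Finset (Fin N)) (S : Finset (Cube N)) (x : Cube N) : ℝ :=
  ∑ y ∈ S, ew θ A x y

def Zb {N : ℕ} (θ : ℝ) (A : Finset (Fin N)) (S : Finset (Cube N)) (i : Fin N) (b : Bool)
    (x : Cube N) : ℝ :=
  ∑ y ∈ S, if y i = b then ew θ A x y else 0

lemma ew_pos {N : ℕ} (θ : ℝ) (A : Finset (Fin N)) (x y : Cube N) : 0 < ew θ A x y :=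
  Real.exp_pos _

lemma Zp_pos {N : ℕ} (θ : ℝ) (A : Finset (Fin N)) {S : Finset (Cube N)} (hS : S.Nonempty)
    (x : Cube N) : 0 < Zp θ A S x := Finset.sum_pos (fun _ _ => ew_pos _ _ _ _) hS

lemma Zb_nonneg {N : ℕ} (θ : ℝ) (A : Finset (Fin N)) (S : Finset (Cube N)) (i : Fin N) (b : Bool)
    (x : Cube N) : 0 ≤ Zb θ A S i b x := by
  apply Finset.sum_nonneg; intro y _; split_ifs
  · exact (ew_pos _ _ _ _).le
  · exact le_rfl

lemma Zb_add {N : ℕ} (θ : ℝ) (A : Finset (Fin N)) (S : Finset (Cube N)) (i : Fin N)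
    (x : Cube N) : Zb θ A S i true x + Zb θ A S i false x = Zp θ A S x := by
  unfold Zb Zp
  rw [← Finset.sum_add_distrib]
  refine Finset.sum_congr rfl fun y _ => ?_
  cases y i <;> simp

lemma ew_update {N : ℕ} (θ : ℝ) {A : Finset (Fin N)} {i : Fin N} (hi : i ∉ A) (x y : Cube N)
    (b : Bool) : ew θ A (Function.update x i b) y = ew θ A x y := by
  unfold ew
  congr 2
  refine Finset.sum_congr rfl fun j hj => ?_
  rw [Function.update_of_ne (by rintro rfl; exact hi hj)]

lemma ew_insert_update {N : ℕ} (θ : ℝ) {A : Finset (Fin N)} {i : Fin N} (hi : i ∉ A) (x y : Cube N)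
    (b : Bool) : ew θ (insert i A) (Function.update x i b) y
      = Real.exp (θ * (pmVal b * pmVal (y i))) * ew θ A x y := by
  rw [← ew_update θ hi x y b]
  unfold ew
  rw [Finset.sum_insert hi, mul_add, Real.exp_add]
  simp

lemma Zp_update {N : ℕ} (θ : ℝ) {A : Finset (Fin N)} {i : Fin N} (hi : i ∉ A)
    (S : Finset (Cube N)) (x : Cube N) (b : Bool) :
    Zp θ A S (Function.update x i b) = Zp θ A S x := by
  unfold Zp; simp_rw [ew_update θ hi]

lemma Zp_insert_true {N : ℕ} (θ : ℝ) {A : Finset (Fin N)} {i : Fin N} (hi : i ∉ A)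
    (S : Finset (Cube N)) (x : Cube N) :
    Zp θ (insert i A) S (Function.update x i true)
      = Real.exp θ * Zb θ A S i true x + Real.exp (-θ) * Zb θ A S i false x := by
  unfold Zp Zb
  rw [Finset.mul_sum, Finset.mul_sum, ← Finset.sum_add_distrib]
  refine Finset.sum_congr rfl fun y _ => ?_
  rw [ew_insert_update θ hi]
  cases y i <;> simp [pmVal]

lemma Zp_insert_false {N : ℕ} (θ : ℝ) {A : Finset (Fin N)} {i : Fin N} (hi : i ∉ A)
    (S : Finset (Cube N)) (x : Cube N) :
    Zp θ (insert i A) S (Function.update x i false)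
      = Real.exp (-θ) * Zb θ A S i true x + Real.exp θ * Zb θ A S i false x := by
  unfold Zp Zb
  rw [Finset.mul_sum, Finset.mul_sum, ← Finset.sum_add_distrib]
  refine Finset.sum_congr rfl fun y _ => ?_
  rw [ew_insert_update θ hi]
  cases y i <;> simp [pmVal]

lemma log_incr {P Q θ : ℝ} (hP : 0 ≤ P) (hQ : 0 ≤ Q) (hPQ : 0 < P + Q) (h0 : 0 ≤ θ)
    (h1 : θ ≤ 1) :
    Real.log (P + Q) + θ ^ 2 / 2 * (min P Q / (P + Q)) ≤
      1 / 2 * Real.log (Real.exp θ * P + Real.exp (-θ) * Q)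
        + (1 - 1 / 2) * Real.log (Real.exp (-θ) * P + Real.exp θ * Q) := by
  have hpos1 : 0 < Real.exp θ * P + Real.exp (-θ) * Q := by
    rcases hP.eq_or_lt with h | h
    · have : 0 < Q := by linarith
      positivity
    · positivity
  have hpos2 : 0 < Real.exp (-θ) * P + Real.exp θ * Q := by
    rcases hP.eq_or_lt with h | h
    · have : 0 < Q := by linarith
      positivity
    · positivity
  have hc : 2 * θ ^ 2 + 1 ≤ Real.cosh (2 * θ) := by
    have h5 := Real.self_le_sinh_iff.2 h0
    have h6 := Real.cosh_two_mul θ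
    have h7 := Real.cosh_sq θ
    nlinarith
  have hprod : (P + Q) ^ 2 + 4 * θ ^ 2 * (P * Q) ≤
      (Real.exp θ * P + Real.exp (-θ) * Q) * (Real.exp (-θ) * P + Real.exp θ * Q) := by
    have e1 : Real.exp θ * Real.exp (-θ) = 1 := by rw [← Real.exp_add]; simp
    have e2 : Real.exp θ * Real.exp θ + Real.exp (-θ) * Real.exp (-θ) = 2 * Real.cosh (2 * θ) := by
      rw [← Real.exp_add, ← Real.exp_add, Real.cosh_eq]; ring_nf
    have e3 : (Real.exp θ * P + Real.exp (-θ) * Q) * (Real.exp (-θ) * P + Real.exp θ * Q)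
        = (Real.exp θ * Real.exp (-θ)) * (P ^ 2 + Q ^ 2)
          + (Real.exp θ * Real.exp θ + Real.exp (-θ) * Real.exp (-θ)) * (P * Q) := by ring
    rw [e3, e1, e2]
    nlinarith [mul_nonneg hP hQ]
  set u := 4 * θ ^ 2 * (P * Q) / (P + Q) ^ 2 with hu
  have hu0 : 0 ≤ u := by positivity
  have hu1 : u ≤ 1 := by
    rw [hu, div_le_one (by positivity)]
    nlinarith [sq_nonneg (P - Q), mul_nonneg hP hQ, mul_nonneg (mul_nonneg hP hQ) (by nlinarith : 0 ≤ 1 - θ ^ 2)]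
  have hlog : u / 2 ≤ Real.log (1 + u) := by
    rw [Real.le_log_iff_exp_le (by positivity)]
    have := Real.abs_exp_sub_one_sub_id_le (x := u / 2) (by rw [abs_of_nonneg] <;> linarith)
    have := (abs_le.1 this).2
    nlinarith
  have hsum : 1 / 2 * Real.log (Real.exp θ * P + Real.exp (-θ) * Q)
        + (1 - 1 / 2) * Real.log (Real.exp (-θ) * P + Real.exp θ * Q)
      = 1 / 2 * Real.log ((Real.exp θ * P + Real.exp (-θ) * Q) * (Real.exp (-θ) * P + Real.exp θ * Q)) := by
    rw [Real.log_mul hpos1.ne' hpos2.ne']; ring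
  rw [hsum]
  have h2 : Real.log ((P + Q) ^ 2 * (1 + u)) ≤ Real.log ((Real.exp θ * P + Real.exp (-θ) * Q) * (Real.exp (-θ) * P + Real.exp θ * Q)) := by
    apply Real.log_le_log (by positivity)
    refine le_trans (le_of_eq ?_) hprod
    rw [hu]; field_simp
  rw [Real.log_mul (by positivity) (by positivity), Real.log_pow] at h2
  push_cast at h2
  have h3 : θ ^ 2 / 2 * (min P Q / (P + Q)) ≤ u / 4 := by
    have : min P Q * (P + Q) ≤ 2 * (P * Q) := by
      rcases le_total P Q with h | h
      · rw [min_eq_left h]; nlinarith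
      · rw [min_eq_right h]; nlinarith
    have e : u / 4 - θ ^ 2 / 2 * (min P Q / (P + Q))
        = θ ^ 2 / 2 * ((2 * (P * Q) - min P Q * (P + Q)) / (P + Q) ^ 2) := by
      rw [hu]; field_simp
    have : 0 ≤ θ ^ 2 / 2 * ((2 * (P * Q) - min P Q * (P + Q)) / (P + Q) ^ 2) :=
      mul_nonneg (by positivity) (div_nonneg (by linarith) (by positivity))
    linarith
  linarith

def gI {N : ℕ} (θ : ℝ) (A : Finset (Fin N)) (S : Finset (Cube N)) (i : Fin N) : ℝ :=
  bE (1/2) (fun x => min (Zb θ A S i true x) (Zb θ A S i false x) / Zp θ A S x)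

lemma gI_nonneg {N : ℕ} (θ : ℝ) (A : Finset (Fin N)) {S : Finset (Cube N)} (hS : S.Nonempty)
    (i : Fin N) : 0 ≤ gI θ A S i := by
  apply bE_nonneg (by norm_num) (by norm_num)
  intro x
  exact div_nonneg (le_min (Zb_nonneg _ _ _ _ _ _) (Zb_nonneg _ _ _ _ _ _)) (Zp_pos θ A hS x).le

lemma gI_le {N : ℕ} (θ : ℝ) (A : Finset (Fin N)) {S : Finset (Cube N)} (hS : S.Nonempty)
    (i : Fin N) : gI θ A S i ≤ 1 / 2 := by
  rw [← bE_const (X := Fin N) (1/2) (1/2)]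
  apply bE_mono (by norm_num) (by norm_num)
  intro x
  rw [div_le_iff₀ (Zp_pos θ A hS x), ← Zb_add θ A S i x]
  rcases le_total (Zb θ A S i true x) (Zb θ A S i false x) with h | h
  · rw [min_eq_left h]; linarith
  · rw [min_eq_right h]; linarith

lemma incr {N : ℕ} {θ : ℝ} (h0 : 0 ≤ θ) (h1 : θ ≤ 1) {A : Finset (Fin N)} {i : Fin N}
    (hi : i ∉ A) {S : Finset (Cube N)} (hS : S.Nonempty) :
    bE (1/2) (fun x => Real.log (Zp θ A S x)) + θ ^ 2 / 2 * gI θ A S i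
      ≤ bE (1/2) (fun x => Real.log (Zp θ (insert i A) S x)) := by
  rw [← bE_av (1/2) i (fun x => Real.log (Zp θ (insert i A) S x)), gI, ← bE_mul_left, ← bE_add]
  apply bE_mono (by norm_num) (by norm_num)
  intro x
  simp only [av]
  rw [Zp_insert_true θ hi, Zp_insert_false θ hi, ← Zb_add θ A S i x]
  exact log_incr (Zb_nonneg _ _ _ _ _ _) (Zb_nonneg _ _ _ _ _ _)
    (by rw [Zb_add]; exact Zp_pos θ A hS x) h0 h1

lemma incr_mono {N : ℕ} {θ : ℝ} (h0 : 0 ≤ θ) (h1 : θ ≤ 1) (A B : Finset (Fin N))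
    {S : Finset (Cube N)} (hS : S.Nonempty) :
    bE (1/2) (fun x => Real.log (Zp θ A S x)) ≤ bE (1/2) (fun x => Real.log (Zp θ (B ∪ A) S x)) := by
  induction B using Finset.induction_on with
  | empty => simp
  | insert i B _ ih =>
    rw [Finset.insert_union]
    by_cases hi : i ∈ B ∪ A
    · rw [Finset.insert_eq_of_mem hi]; exact ih
    · have := incr h0 h1 hi hS
      have := gI_nonneg θ (B ∪ A) hS i
      have : 0 ≤ θ ^ 2 / 2 * gI θ (B ∪ A) S i := by positivity
      linarith

lemma abs_sum_le {N : ℕ} (A : Finset (Fin N)) (x y : Cube N) :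
    |∑ i ∈ A, pmVal (x i) * pmVal (y i)| ≤ N := by
  calc _ ≤ ∑ i ∈ A, |pmVal (x i) * pmVal (y i)| := Finset.abs_sum_le_sum_abs _ _
    _ = A.card := by simp [abs_mul, abs_pmVal]
    _ ≤ N := by exact_mod_cast (Finset.card_le_univ A).trans (by simp)

lemma sum_gI {N : ℕ} {θ δ : ℝ} (h0 : 0 ≤ θ) (hδ : 0 < δ) (h1 : θ ≤ δ / 4) (A : Finset (Fin N))
    {S : Finset (Cube N)} (hS : Real.exp (δ * N) ≤ S.card) :
    δ ^ 2 * N / 16 ≤ ∑ i, gI θ A S i := by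
  have hne : S.Nonempty := by
    rw [← Finset.card_pos]
    have : (0 : ℝ) < S.card := lt_of_lt_of_le (Real.exp_pos _) hS
    exact_mod_cast this
  unfold gI
  rw [← bE_sum, ← bE_const (X := Fin N) (1/2) (δ ^ 2 * N / 16)]
  apply bE_mono (by norm_num) (by norm_num)
  intro x
  rw [← Finset.sum_div, le_div_iff₀ (Zp_pos θ A hne x)]
  apply gibbs_bound S (fun y => ew θ A x y) hδ (fun y _ => ew_pos _ _ _ _)
  intro y _
  have hN : (0 : ℝ) ≤ N := Nat.cast_nonneg _
  have hlow : S.card * Real.exp (-(θ * N)) ≤ ∑ y ∈ S, ew θ A x y := by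
    rw [← nsmul_eq_mul, ← Finset.sum_const]
    apply Finset.sum_le_sum
    intro y _
    apply Real.exp_le_exp.2
    have := (abs_le.1 (abs_sum_le A x y)).1
    nlinarith
  refine le_trans ?_ ((mul_le_mul_of_nonneg_right hS (Real.exp_pos _).le).trans hlow)
  unfold ew
  rw [← Real.exp_add, ← Real.exp_add]
  apply Real.exp_le_exp.2
  have h2 := (abs_le.1 (abs_sum_le A x y)).2
  have h3 := mul_le_mul_of_nonneg_left h2 h0
  have h4 := mul_le_mul_of_nonneg_right h1 hN
  linarith

lemma greedy {N : ℕ} (hN : 0 < N) {θ δ : ℝ} (h0 : 0 ≤ θ) (hδ : 0 < δ) (hδ1 : δ ≤ 1)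
    (h1 : θ ≤ δ / 4) {S : Finset (Cube N)} (hS : Real.exp (δ * N) ≤ S.card) (k : ℕ)
    (hk : (k : ℝ) ≤ δ ^ 2 * N / 16 + 1) :
    ∃ A : Finset (Fin N), A.card = k ∧
      Real.log S.card + k * (θ ^ 2 * δ ^ 2 / 64) ≤ bE (1/2) (fun x => Real.log (Zp θ A S x)) := by
  have hne : S.Nonempty := by
    rw [← Finset.card_pos]
    have : (0 : ℝ) < S.card := lt_of_lt_of_le (Real.exp_pos _) hS
    exact_mod_cast this
  induction k with
  | zero =>
    refine ⟨∅, rfl, ?_⟩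
    simp [Zp, ew, bE_const]
  | succ k ih =>
    push_cast at hk
    obtain ⟨A, hA, hA2⟩ := ih (by linarith)
    have hNr : (0 : ℝ) < N := by exact_mod_cast hN
    have hsum := sum_gI h0 hδ h1 A hS
    rw [← Finset.sum_add_sum_compl A] at hsum
    have hA3 : ∑ i ∈ A, gI θ A S i ≤ k / 2 := by
      calc _ ≤ ∑ i ∈ A, (1 / 2 : ℝ) := Finset.sum_le_sum fun i _ => gI_le θ A hne i
        _ = _ := by simp [hA, div_eq_mul_inv]
    have hex : ∃ i ∈ Aᶜ, δ ^ 2 / 32 ≤ gI θ A S i := by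
      apply Finset.exists_le_of_sum_le
      · by_contra hcon
        rw [Finset.not_nonempty_iff_eq_empty] at hcon
        rw [hcon, Finset.sum_empty] at hsum
        have : 0 < δ ^ 2 * N := by positivity
        linarith
      · rw [Finset.sum_const, nsmul_eq_mul]
        have : ((Aᶜ).card : ℝ) ≤ N := by
          exact_mod_cast (Finset.card_le_univ _).trans (by simp)
        have := mul_le_mul_of_nonneg_right this (by positivity : 0 ≤ δ ^ 2 / 32)
        linarith
    obtain ⟨i, hi, hi2⟩ := hex
    rw [Finset.mem_compl] at hi
    refine ⟨insert i A, by rw [Finset.card_insert_of_notMem hi, hA], ?_⟩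
    have h2 := incr h0 (by linarith) hi hne
    have h3 := mul_le_mul_of_nonneg_left hi2 (by positivity : 0 ≤ θ ^ 2 / 2)
    push_cast
    linarith

lemma mean_lower {N : ℕ} (hN : 0 < N) {θ δ : ℝ} (h0 : 0 ≤ θ) (hδ : 0 < δ) (hδ1 : δ ≤ 1)
    (h1 : θ ≤ δ / 4) {S : Finset (Cube N)} (hS : Real.exp (δ * N) ≤ S.card) :
    Real.log S.card + θ ^ 2 * δ ^ 4 * N / 1024
      ≤ bE (1/2) (fun x => Real.log (Zp θ Finset.univ S x)) := by
  have hne : S.Nonempty := by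
    rw [← Finset.card_pos]
    have : (0 : ℝ) < S.card := lt_of_lt_of_le (Real.exp_pos _) hS
    exact_mod_cast this
  obtain ⟨A, _, hA⟩ := greedy hN h0 hδ hδ1 h1 hS ⌈δ ^ 2 * N / 16⌉₊
    (Nat.ceil_lt_add_one (by positivity)).le
  have h2 := incr_mono h0 (by linarith) A Finset.univ hne
  rw [Finset.union_eq_left.2 (Finset.subset_univ A)] at h2
  have h3 := mul_le_mul_of_nonneg_right (Nat.le_ceil (δ ^ 2 * N / 16))
    (by positivity : 0 ≤ θ ^ 2 * δ ^ 2 / 64)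
  nlinarith

lemma lip {N : ℕ} {θ : ℝ} (h0 : 0 ≤ θ) {S : Finset (Cube N)} (hS : S.Nonempty) (i : Fin N)
    (x : Cube N) : |dd i (fun x => Real.log (Zp θ Finset.univ S x)) x| ≤ 2 * θ := by
  have key : ∀ b b' : Bool, Real.log (Zp θ Finset.univ S (Function.update x i b))
      ≤ 2 * θ + Real.log (Zp θ Finset.univ S (Function.update x i b')) := by
    intro b b'
    have hp := Zp_pos θ Finset.univ hS (Function.update x i b')
    rw [← Real.log_exp (2 * θ), ← Real.log_mul (Real.exp_pos _).ne' hp.ne']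
    apply Real.log_le_log (Zp_pos _ _ hS _)
    unfold Zp
    rw [Finset.mul_sum]
    apply Finset.sum_le_sum
    intro y _
    have hi : i ∉ Finset.univ.erase i := by simp
    have e := Finset.insert_erase (Finset.mem_univ i)
    rw [← e, ew_insert_update θ hi, ew_insert_update θ hi, ← mul_assoc (Real.exp (2 * θ)),
      ← Real.exp_add]
    apply mul_le_mul_of_nonneg_right _ (ew_pos _ _ _ _).le
    apply Real.exp_le_exp.2
    have h2 := pm_mul_le b (y i)
    have h3 := pm_mul_ge b' (y i)
    nlinarith
  have h1 := key true false
  have h2 := key false true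
  simp only [dd]
  rw [abs_le]; constructor <;> linarith

lemma mgf_dot {N : ℕ} (t : ℝ) (y : Cube N) :
    bE (1/2) (fun x => Real.exp (t * cubeDot x y)) = Real.cosh t ^ N := by
  have : ∀ x : Cube N, Real.exp (t * cubeDot x y)
      = ∏ i, (fun (i : Fin N) (b : Bool) => Real.exp (t * (pmVal b * pmVal (y i)))) i (x i) := by
    intro x
    rw [← Real.exp_sum, cubeDot, Finset.mul_sum]
  rw [funext this]
  rw [bE_prod (1/2) (fun (i : Fin N) (b : Bool) => Real.exp (t * (pmVal b * pmVal (y i))))]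
  have : ∀ i : Fin N, (1/2 : ℝ) * Real.exp (t * (pmVal true * pmVal (y i)))
      + (1 - 1/2) * Real.exp (t * (pmVal false * pmVal (y i))) = Real.cosh t := by
    intro i
    rw [Real.cosh_eq]
    cases y i <;> simp [pmVal] <;> ring
  simp_rw [this]
  simp

lemma markov {X : Type*} [Fintype X] [DecidableEq X] {p : ℝ} (h0 : 0 ≤ p) (h1 : p ≤ 1)
    (F : (X → Bool) → ℝ) (hF : ∀ ω, 0 ≤ F ω) {t : ℝ} (ht : 0 < t) :
    bE p (fun ω => if t < F ω then 1 else 0) ≤ bE p F / t := by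
  rw [le_div_iff₀ ht, mul_comm, ← bE_mul_left]
  apply bE_mono h0 h1
  intro ω
  split_ifs with h
  · linarith
  · simpa using hF ω

lemma exp_two_dot {N : ℕ} (S : Finset (Cube N)) (θ : ℝ) :
    bE (1/2) (fun x => ∑ y ∈ S, Real.exp (2 * (θ * cubeDot x y)))
      ≤ S.card * Real.exp (2 * (θ ^ 2 * N)) := by
  rw [bE_sum]
  rw [← nsmul_eq_mul, ← Finset.sum_const]
  apply Finset.sum_le_sum
  intro y _
  have : bE (1/2) (fun x : Cube N => Real.exp (2 * (θ * cubeDot x y))) = Real.cosh (2 * θ) ^ N := by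
    rw [← mgf_dot (2 * θ) y]
    congr 1; ext x; ring_nf
  rw [this]
  calc Real.cosh (2 * θ) ^ N ≤ Real.exp ((2 * θ) ^ 2 / 2) ^ N :=
        pow_le_pow_left₀ (Real.cosh_pos _).le (Real.cosh_le_exp_half_sq _) N
    _ = _ := by rw [← Real.exp_nat_mul]; ring_nf

set_option maxHeartbeats 1600000 in
lemma add_one (κ : ℝ) {N : ℕ} (hN : κ ^ 2 + 1 ≤ Real.log N) {δ : ℝ} (hδ : 0 < δ) (hδ1 : δ ≤ 1)
    (hbig : 2 ^ 29 * Real.log N / δ ^ 10 ≤ N) {S : Finset (Cube N)}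
    (hS : Real.exp (δ * N) ≤ S.card) :
    bE (1/2) (fun x => if ((S.filter (fun y => y ∈ halfCube κ x)).card : ℝ)
        < Real.exp (-(2 ^ 27 * Real.log N / δ ^ 8)) * S.card then 1 else 0)
      ≤ 2 / (N : ℝ) ^ 4 := by
  have hlog : 1 ≤ Real.log N := by nlinarith [sq_nonneg κ]
  have hN0 : 0 < N := by
    rcases Nat.eq_zero_or_pos N with h | h
    · subst h; simp at hlog; linarith
    · exact h
  have hNr : (0 : ℝ) < N := by exact_mod_cast hN0
  have hne : S.Nonempty := by
    rw [← Finset.card_pos]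
    have : (0 : ℝ) < S.card := lt_of_lt_of_le (Real.exp_pos _) hS
    exact_mod_cast this
  have hSpos : (0 : ℝ) < S.card := lt_of_lt_of_le (Real.exp_pos _) hS
  set ℓ := Real.log N with hℓ
  set lam := Real.sqrt (2 ^ 25 * ℓ / δ ^ 8) with hlam
  have hlam2 : lam ^ 2 = 2 ^ 25 * ℓ / δ ^ 8 := Real.sq_sqrt (by positivity)
  have hlam0 : 0 < lam := Real.sqrt_pos.2 (by positivity)
  set θ := lam / Real.sqrt N with hθ
  have hsN : 0 < Real.sqrt N := Real.sqrt_pos.2 hNr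
  have hθ0 : 0 < θ := by positivity
  have hθN : θ ^ 2 * N = lam ^ 2 := by
    rw [hθ, div_pow, Real.sq_sqrt hNr.le]; field_simp
  have hθs : θ * Real.sqrt N = lam := by rw [hθ]; field_simp
  have hθδ : θ ≤ δ / 4 := by
    refine le_of_sq_le_sq' ?_ (by positivity)
    have : θ ^ 2 * N ≤ (δ / 4) ^ 2 * N := by
      rw [hθN, hlam2]
      have := mul_le_mul_of_nonneg_left hbig (by positivity : 0 ≤ (δ / 4) ^ 2)
      refine le_trans (le_of_eq ?_) this
      field_simp
      norm_num
    exact le_of_mul_le_mul_right this hNr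
  have hmean := mean_lower hN0 hθ0.le hδ hδ1 hθδ hS
  set Φ : Cube N → ℝ := fun x => Real.log (Zp θ Finset.univ S x) with hΦ
  set s := lam ^ 2 * δ ^ 4 / 2048 with hs
  have htail := lower_tail (X := Fin N) (c := θ) (s := s) (by simpa using hNr) hθ0
    (by positivity) Φ (fun i x => lip hθ0.le hne i x)
  have htail2 : Real.exp (-(s ^ 2 / (2 * (Fintype.card (Fin N)) * θ ^ 2))) ≤ 1 / (N : ℝ) ^ 4 := by
    have e1 : s ^ 2 / (2 * (Fintype.card (Fin N)) * θ ^ 2) = 4 * ℓ := by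
      rw [Fintype.card_fin, mul_assoc, mul_comm (N : ℝ), hθN, hs]
      have : (lam ^ 2 * δ ^ 4 / 2048) ^ 2 / (2 * lam ^ 2) = lam ^ 2 * (δ ^ 8 / 2 ^ 23) := by
        field_simp; norm_num
      rw [this, hlam2]; field_simp; norm_num
    rw [e1, Real.exp_neg, ← one_div]
    apply le_of_eq
    congr 1
    rw [hℓ, mul_comm, Real.exp_mul, Real.exp_log hNr]
    norm_cast
  have hmk := markov (X := Fin N) (p := 1/2) (by norm_num) (by norm_num)
    (fun x => ∑ y ∈ S, Real.exp (2 * (θ * cubeDot x y)))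
    (fun x => Finset.sum_nonneg fun y _ => (Real.exp_pos _).le)
    (t := S.card * (Real.exp (2 * lam ^ 2) * (N : ℝ) ^ 4)) (by positivity)
  have hmk2 : bE (1/2) (fun x => ∑ y ∈ S, Real.exp (2 * (θ * cubeDot x y)))
      / (S.card * (Real.exp (2 * lam ^ 2) * (N : ℝ) ^ 4)) ≤ 1 / (N : ℝ) ^ 4 := by
    rw [div_le_iff₀ (by positivity)]
    refine (exp_two_dot S θ).trans (le_of_eq ?_)
    rw [hθN]; field_simp
  have hlamκ : lam * |κ| + 1 ≤ lam ^ 2 * δ ^ 4 / 2048 := by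
    have h1 : 2 ^ 12 * (|κ| + 1) ≤ lam * δ ^ 4 * 2:= by
      refine le_of_sq_le_sq' ?_ (by positivity)
      have : (lam * δ ^ 4 * 2) ^ 2 = 2 ^ 27 * ℓ := by
        rw [mul_pow, mul_pow, hlam2]; field_simp
      rw [this]
      nlinarith [sq_abs κ, sq_nonneg (|κ| - 1), abs_nonneg κ]
    have h2 : 1 ≤ lam := by
      refine le_of_sq_le_sq' ?_ hlam0.le
      rw [hlam2, le_div_iff₀ (by positivity)]
      have : δ ^ 8 ≤ 1 := pow_le_one₀ hδ.le hδ1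
      nlinarith
    have h3 := mul_le_mul_of_nonneg_left h1 hlam0.le
    nlinarith
  have hpt : ∀ x : Cube N, (if ((S.filter (fun y => y ∈ halfCube κ x)).card : ℝ)
        < Real.exp (-(2 ^ 27 * ℓ / δ ^ 8)) * S.card then (1:ℝ) else 0)
      ≤ (if Φ x < bE (1/2) Φ - s then 1 else 0)
        + (if S.card * (Real.exp (2 * lam ^ 2) * (N : ℝ) ^ 4)
            < ∑ y ∈ S, Real.exp (2 * (θ * cubeDot x y)) then 1 else 0) := by
    intro x
    by_cases ha : Φ x < bE (1/2) Φ - s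
    · rw [if_pos ha]; split_ifs <;> norm_num
    by_cases hb : S.card * (Real.exp (2 * lam ^ 2) * (N : ℝ) ^ 4)
            < ∑ y ∈ S, Real.exp (2 * (θ * cubeDot x y))
    · rw [if_pos hb]; split_ifs <;> norm_num
    rw [if_neg ha, if_neg hb, if_neg]
    · norm_num
    push Not at ha hb ⊢
    have hlow : Real.log S.card + (lam * |κ| + 1) ≤ Φ x := by
      have : θ ^ 2 * δ ^ 4 * N / 1024 = 2 * s := by rw [hs, ← hθN]; ring
      rw [this] at hmean
      linarith
    have hZ : (S.card : ℝ) * (Real.exp (lam * |κ|) + 1) ≤ ∑ y ∈ S, Real.exp (θ * cubeDot x y) := by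
      have e1 : Zp θ Finset.univ S x = ∑ y ∈ S, Real.exp (θ * cubeDot x y) := rfl
      rw [← e1, ← Real.exp_log (Zp_pos θ Finset.univ hne x)]
      refine le_trans ?_ (Real.exp_le_exp.2 hlow)
      rw [Real.exp_add, Real.exp_log hSpos, Real.exp_add]
      apply mul_le_mul_of_nonneg_left _ hSpos.le
      have h1 : 1 ≤ Real.exp (lam * |κ|) := Real.one_le_exp (by positivity)
      have h2 : 2 ≤ Real.exp 1 := by linarith [Real.add_one_le_exp 1]
      nlinarith
    have hcs := cs_tail S (fun y => θ * cubeDot x y) (fun y => y ∈ halfCube κ x)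
      (a := lam * |κ|) (B := Real.exp (2 * lam ^ 2) * (N : ℝ) ^ 4) (by positivity) (by
        intro y _ hy
        simp only [halfCube, Set.mem_ofPred_eq, ge_iff_le, not_le] at hy
        have h1 := mul_le_mul_of_nonneg_left hy.le hθ0.le
        have h2 : θ * (κ * Real.sqrt N) = lam * κ := by rw [← hθs]; ring
        have h3 := mul_le_mul_of_nonneg_left (le_abs_self κ) hlam0.le
        linarith) hZ hb
    refine le_trans ?_ hcs
    rw [le_div_iff₀ (by positivity)]
    have e2 : (N : ℝ) ^ 4 = Real.exp (4 * ℓ) := by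
      rw [hℓ, mul_comm, Real.exp_mul, Real.exp_log hNr]; norm_cast
    rw [e2, mul_right_comm, ← Real.exp_add, ← Real.exp_add, mul_comm]
    apply mul_le_of_le_one_right hSpos.le
    rw [Real.exp_le_one_iff, hlam2]
    have : ℓ ≤ ℓ / δ ^ 8 := by
      rw [le_div_iff₀ (by positivity)]
      have : δ ^ 8 ≤ 1 := pow_le_one₀ hδ.le hδ1
      nlinarith
    have e3 : (2:ℝ) ^ 27 * ℓ / δ ^ 8 = 2 ^ 27 * (ℓ / δ ^ 8) := by ring
    have e4 : (2:ℝ) ^ 25 * ℓ / δ ^ 8 = 2 ^ 25 * (ℓ / δ ^ 8) := by ring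
    rw [e3, e4]
    norm_num
    linarith
  have hfin := bE_mono (X := Fin N) (p := 1/2) (by norm_num) (by norm_num) hpt
  rw [bE_add] at hfin
  have : (2 : ℝ) / (N : ℝ) ^ 4 = 1 / (N : ℝ) ^ 4 + 1 / (N : ℝ) ^ 4 := by ring
  rw [this]
  linarith

/-! ### The model -/

lemma bWeight_eq {N : ℕ} (p : ℝ) (ω : Cube N → Bool) : bWeight p ω = ∏ x, wt p (ω x) := by
  unfold bWeight
  have h : ∀ x, wt p (ω x) = (if ω x = true then p else 1) * (if ω x = false then 1 - p else 1) := by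
    intro x; cases ω x <;> simp [wt]
  simp_rw [h]
  rw [Finset.prod_mul_distrib, ← Finset.prod_filter, ← Finset.prod_filter]
  simp

lemma bernoulliP_eq {N : ℕ} (p : ℝ) (E : Set (Cube N → Bool)) :
    bernoulliP p E = bE p (fun ω => if ω ∈ E then 1 else 0) := by
  unfold bernoulliP bE
  refine Finset.sum_congr rfl fun ω _ => ?_
  rw [bWeight_eq]
  by_cases h : ω ∈ E <;> simp [h]

def Sol {N : ℕ} (κ : ℝ) (ω : Cube N → Bool) : Finset (Cube N) :=
  Finset.univ.filter (fun y => ∀ x, ω x = true → y ∈ halfCube κ x)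

lemma mem_Sol {N : ℕ} {κ : ℝ} {ω : Cube N → Bool} {y : Cube N} :
    y ∈ Sol κ ω ↔ ∀ x, ω x = true → y ∈ halfCube κ x := by
  simp [Sol]

lemma mem_emptyInter {N : ℕ} (κ : ℝ) (ω : Cube N → Bool) :
    ω ∈ emptyInter κ ↔ Sol κ ω = ∅ := by
  unfold emptyInter
  rw [Set.mem_ofPred_eq, Set.eq_empty_iff_forall_notMem, Finset.eq_empty_iff_forall_notMem]
  refine forall_congr' fun y => not_congr ?_
  rw [mem_Sol]
  simp

lemma bE_half {N : ℕ} (F : Cube N → ℝ) : bE (1/2) F = (∑ x, F x) / 2 ^ N := by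
  unfold bE
  have : ∀ x : Cube N, ∏ i, wt (1/2) (x i) = 1 / 2 ^ N := by
    intro x
    have : ∀ i, wt (1/2) (x i) = 1 / 2 := by
      intro i; unfold wt; split_ifs <;> norm_num
    simp_rw [this]
    simp
  simp_rw [this]
  rw [← Finset.mul_sum]; ring

lemma card_cube (N : ℕ) : ((Finset.univ : Finset (Cube N)).card : ℝ) = 2 ^ N := by
  simp

lemma exp_quarter_le_cosh {θ : ℝ} (h0 : 0 ≤ θ) (h1 : θ ^ 2 ≤ 2) :
    Real.exp (θ ^ 2 / 4) ≤ Real.cosh θ := by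
  have h5 := Real.self_le_sinh_iff.2 (by linarith : 0 ≤ θ / 2)
  have h6 := Real.cosh_two_mul (θ / 2)
  have h7 := Real.cosh_sq (θ / 2)
  rw [mul_div_cancel₀ _ (two_ne_zero)] at h6
  have h8 : 1 + θ ^ 2 / 2 ≤ Real.cosh θ := by nlinarith
  have h9 := Real.abs_exp_sub_one_sub_id_le (x := θ ^ 2 / 4)
    (by rw [abs_of_nonneg (by positivity)]; linarith)
  have := (abs_le.1 h9).2
  nlinarith [sq_nonneg θ]

lemma fail_count (κ : ℝ) : ∃ r : ℝ, 0 < r ∧ r ≤ 1 ∧ ∃ N1 : ℕ, ∀ N : ℕ, N1 ≤ N → ∀ y : Cube N,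
    r * 2 ^ N ≤ ((Finset.univ.filter (fun x => y ∉ halfCube κ x)).card : ℝ) := by
  set lam := 4 * |κ| + 4 with hlam
  have hlam4 : 4 ≤ lam := by have := abs_nonneg κ; linarith
  refine ⟨Real.exp (-(2 * lam ^ 2)), Real.exp_pos _, ?_, ⌈lam ^ 2⌉₊ + 1, ?_⟩
  · rw [Real.exp_le_one_iff]; nlinarith
  intro N hN y
  have hN1 : lam ^ 2 ≤ N := (Nat.le_ceil _).trans (by exact_mod_cast (by omega))
  have hNr : (0 : ℝ) < N := by nlinarith
  have hsN : 0 < Real.sqrt N := Real.sqrt_pos.2 hNr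
  set θ := lam / Real.sqrt N with hθ
  have hθ0 : 0 ≤ θ := by positivity
  have hθN : θ ^ 2 * N = lam ^ 2 := by
    rw [hθ, div_pow, Real.sq_sqrt hNr.le]; field_simp
  have hθs : θ * Real.sqrt N = lam := by rw [hθ]; field_simp
  have hm : ∀ t : ℝ, ∑ x : Cube N, Real.exp (t * cubeDot x y) = 2 ^ N * Real.cosh t ^ N := by
    intro t
    have := mgf_dot t y
    rw [bE_half, div_eq_iff (by positivity)] at this
    rw [this]; ring
  have hcs := cs_tail (Finset.univ : Finset (Cube N)) (fun x => -θ * cubeDot x y)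
    (fun x => y ∉ halfCube κ x) (a := lam * |κ|) (B := Real.exp (2 * lam ^ 2)) (Real.exp_pos _)
    (by
      intro x _ hx
      simp only [halfCube, Set.mem_ofPred_eq, not_not, ge_iff_le] at hx
      have h1 := mul_le_mul_of_nonneg_left hx hθ0
      have h2 : θ * (κ * Real.sqrt N) = lam * κ := by rw [← hθs]; ring
      have h3 := mul_le_mul_of_nonneg_left (neg_abs_le κ) (by linarith : 0 ≤ lam)
      linarith)
    (by
      rw [hm, card_cube, Real.cosh_neg]
      apply mul_le_mul_of_nonneg_left _ (by positivity)
      have h1 : Real.exp (lam ^ 2 / 4) ≤ Real.cosh θ ^ N := by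
        calc Real.exp (lam ^ 2 / 4) = Real.exp (θ ^ 2 / 4) ^ N := by
              rw [← Real.exp_nat_mul, ← hθN]; ring_nf
          _ ≤ _ := by
              apply pow_le_pow_left₀ (Real.exp_pos _).le
              apply exp_quarter_le_cosh hθ0
              have : θ ^ 2 * N ≤ 2 * N := by rw [hθN]; linarith
              exact le_of_mul_le_mul_right this hNr
      refine le_trans ?_ h1
      have e : lam ^ 2 / 4 = lam * |κ| + lam := by rw [hlam]; ring
      rw [e, Real.exp_add]
      have h2 : 1 ≤ Real.exp (lam * |κ|) := Real.one_le_exp (by positivity)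
      have h3 : 2 ≤ Real.exp lam := by linarith [Real.add_one_le_exp lam]
      nlinarith)
    (by
      have : ∀ x : Cube N, Real.exp (2 * (-θ * cubeDot x y)) = Real.exp ((-(2 * θ)) * cubeDot x y) := by
        intro x; ring_nf
      simp_rw [this]
      rw [hm, card_cube, Real.cosh_neg]
      apply mul_le_mul_of_nonneg_left _ (by positivity)
      calc Real.cosh (2 * θ) ^ N ≤ Real.exp ((2 * θ) ^ 2 / 2) ^ N :=
            pow_le_pow_left₀ (Real.cosh_pos _).le (Real.cosh_le_exp_half_sq _) N
        _ = _ := by rw [← Real.exp_nat_mul, ← hθN]; ring_nf)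
  rw [card_cube] at hcs
  rw [Real.exp_neg, mul_comm, ← div_eq_mul_inv]
  exact hcs

lemma prob_mem_Sol {N : ℕ} (κ : ℝ) {r s : ℝ} (h1 : s ≤ 1) (h0 : 0 ≤ s) (y : Cube N)
    (hr : r * 2 ^ N ≤ ((Finset.univ.filter (fun x => y ∉ halfCube κ x)).card : ℝ)) :
    bE s (fun σ => if y ∈ Sol κ σ then 1 else 0) ≤ Real.exp (-(s * (r * 2 ^ N))) := by
  have h : ∀ σ : Cube N → Bool, (if y ∈ Sol κ σ then (1:ℝ) else 0)
      = ∏ x, (fun (x : Cube N) (b : Bool) => if b = true ∧ y ∉ halfCube κ x then (0:ℝ) else 1) x (σ x) := by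
    intro σ
    by_cases hy : y ∈ Sol κ σ
    · rw [if_pos hy, Finset.prod_eq_one]
      intro x _
      rw [mem_Sol] at hy
      refine if_neg ?_
      rintro ⟨h1, h2⟩
      exact h2 (hy x h1)
    · rw [if_neg hy]
      rw [mem_Sol] at hy
      push Not at hy
      obtain ⟨x, hx, hx2⟩ := hy
      rw [Finset.prod_eq_zero (Finset.mem_univ x)]
      simp [hx, hx2]
  rw [funext h]
  have h2 : ∀ x : Cube N, s * (if true = true ∧ y ∉ halfCube κ x then (0:ℝ) else 1)
      + (1 - s) * (if false = true ∧ y ∉ halfCube κ x then (0:ℝ) else 1)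
      = if y ∉ halfCube κ x then 1 - s else 1 := by
    intro x; by_cases hx : y ∈ halfCube κ x <;> simp [hx]
  refine ((bE_prod s (fun (x : Cube N) (b : Bool) =>
    if b = true ∧ y ∉ halfCube κ x then (0:ℝ) else 1)).trans
    (Finset.prod_congr rfl fun x _ => h2 x)).le.trans ?_
  rw [← Finset.prod_filter, Finset.prod_const]
  calc (1 - s) ^ _ ≤ Real.exp (-s) ^ _ := by
        apply pow_le_pow_left₀ (by linarith)
        linarith [Real.add_one_le_exp (-s)]
    _ = Real.exp (-(s * ((Finset.univ.filter (fun x => y ∉ halfCube κ x)).card : ℝ))) := by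
        rw [← Real.exp_nat_mul]; ring_nf
    _ ≤ _ := by
        apply Real.exp_le_exp.2
        have := mul_le_mul_of_nonneg_left hr h0
        linarith

lemma kill {N : ℕ} (κ : ℝ) {r s : ℝ} (h1 : s ≤ 1) (h0 : 0 ≤ s) (S : Finset (Cube N))
    (hr : ∀ y : Cube N, r * 2 ^ N ≤ ((Finset.univ.filter (fun x => y ∉ halfCube κ x)).card : ℝ)) :
    bE s (fun σ => if ∃ y ∈ S, y ∈ Sol κ σ then 1 else 0)
      ≤ S.card * Real.exp (-(s * (r * 2 ^ N))) := by
  calc _ ≤ bE s (fun σ => ∑ y ∈ S, if y ∈ Sol κ σ then (1:ℝ) else 0) := by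
        apply bE_mono h0 h1
        intro σ
        split_ifs with h
        · obtain ⟨y, hy, hy2⟩ := h
          have := Finset.single_le_sum (f := fun y => if y ∈ Sol κ σ then (1:ℝ) else 0)
            (fun i _ => by split_ifs <;> norm_num) hy
          simpa [hy2] using this
        · exact Finset.sum_nonneg fun i _ => by split_ifs <;> norm_num
    _ = ∑ y ∈ S, bE s (fun σ => if y ∈ Sol κ σ then (1:ℝ) else 0) := bE_sum _ _ _
    _ ≤ ∑ y ∈ S, Real.exp (-(s * (r * 2 ^ N))) :=
        Finset.sum_le_sum fun y _ => prob_mem_Sol κ h1 h0 y (hr y)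
    _ = _ := by rw [Finset.sum_const, nsmul_eq_mul]

/-- truncated free energy -/
def FE {N : ℕ} (κ δ : ℝ) (ω : Cube N → Bool) : ℝ := max (Real.log (Sol κ ω).card) (δ * N)

lemma Sol_update {N : ℕ} (κ : ℝ) (ω : Cube N → Bool) (x : Cube N) (hx : ω x = false) :
    Sol κ (Function.update ω x true) = (Sol κ ω).filter (fun y => y ∈ halfCube κ x) := by
  ext y
  rw [Finset.mem_filter, mem_Sol, mem_Sol]
  constructor
  · intro h
    refine ⟨fun z hz => h z ?_, h x (by simp)⟩
    rw [Function.update_of_ne]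
    · exact hz
    · rintro rfl; rw [hx] at hz; cases hz
  · rintro ⟨h1, h2⟩ z hz
    by_cases hzx : z = x
    · subst hzx; exact h2
    · rw [Function.update_of_ne hzx] at hz; exact h1 z hz

lemma log_Sol_le {N : ℕ} (κ : ℝ) (ω : Cube N → Bool) :
    Real.log (Sol κ ω).card ≤ N * Real.log 2 := by
  rcases Nat.eq_zero_or_pos (Sol κ ω).card with h | h
  · rw [h]; simp; positivity
  · rw [← Real.log_pow]
    apply Real.log_le_log (by exact_mod_cast h)
    rw [← card_cube]
    exact_mod_cast Finset.card_le_univ _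

lemma drop {N : ℕ} (κ : ℝ) {δ T : ℝ} (hδ : 0 < δ) (hT : 0 ≤ T) (ω : Cube N → Bool) (x : Cube N)
    (hx : ω x = false) :
    0 ≤ dd x (FE κ δ) ω ∧ dd x (FE κ δ) ω ≤ N ∧
    (((Sol κ ω).card : ℝ) < Real.exp (δ * N) → dd x (FE κ δ) ω = 0) ∧
    (Real.exp (-T) * (Sol κ ω).card ≤ (((Sol κ ω).filter (fun y => y ∈ halfCube κ x)).card : ℝ) →
      dd x (FE κ δ) ω ≤ T) := by
  have e1 : Function.update ω x false = ω := by rw [← hx]; simp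
  simp only [dd, e1, FE, Sol_update κ ω x hx]
  set S := Sol κ ω with hS
  set S' := S.filter (fun y => y ∈ halfCube κ x) with hS'
  have hN : (0 : ℝ) ≤ N := Nat.cast_nonneg _
  have hδN : 0 ≤ δ * N := by positivity
  have hcard : S'.card ≤ S.card := Finset.card_filter_le _ _
  have hcardr : (S'.card : ℝ) ≤ S.card := by exact_mod_cast hcard
  have hlog : Real.log S'.card ≤ Real.log S.card := by
    rcases Nat.eq_zero_or_pos S'.card with h | h
    · rw [h]; simp; exact Real.log_natCast_nonneg _
    · exact Real.log_le_log (by exact_mod_cast h) hcardr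
  have hlog2 : Real.log S.card ≤ N := by
    have h1 := log_Sol_le κ ω
    have := Real.log_two_lt_d9
    rw [← hS] at h1
    nlinarith
  have hlog0 := Real.log_natCast_nonneg S'.card
  refine ⟨?_, ?_, ?_, ?_⟩
  · linarith [max_le_max_right (δ * N) hlog]
  · have : max (Real.log S.card) (δ * N) ≤ N + max (Real.log S'.card) (δ * N) := by
      apply max_le
      · linarith [le_max_right (Real.log S'.card) (δ * N)]
      · linarith [le_max_right (Real.log S'.card) (δ * N)]
    linarith
  · intro h
    have h2 : ∀ n : ℕ, (n : ℝ) ≤ S.card → Real.log n ≤ δ * N := by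
      intro n hn
      rcases Nat.eq_zero_or_pos n with h0 | h0
      · rw [h0]; simpa using hδN
      · rw [Real.log_le_iff_le_exp (by exact_mod_cast h0)]
        linarith
    rw [max_eq_right (h2 _ le_rfl), max_eq_right (h2 _ hcardr), sub_self]
  · intro h
    have : max (Real.log S.card) (δ * N) ≤ T + max (Real.log S'.card) (δ * N) := by
      apply max_le
      · rcases Nat.eq_zero_or_pos S.card with h0 | h0
        · rw [h0]; simp
          linarith [le_max_right (Real.log S'.card) (δ * N)]
        · have h0' : (0:ℝ) < S.card := by exact_mod_cast h0
          have := Real.log_le_log (by positivity) h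
          rw [Real.log_mul (Real.exp_pos _).ne' h0'.ne', Real.log_exp] at this
          linarith [le_max_left (Real.log S'.card) (δ * N)]
      · linarith [le_max_right (Real.log S'.card) (δ * N)]
    linarith

lemma sum_drop (κ : ℝ) {N : ℕ} (hN : κ ^ 2 + 1 ≤ Real.log N) {δ : ℝ} (hδ : 0 < δ) (hδ1 : δ ≤ 1)
    (hbig : 2 ^ 29 * Real.log N / δ ^ 10 ≤ N) (k : ℕ) (hk : k ≤ 2) (hk0 : k ≠ 0)
    (ω : Cube N → Bool) :
    ∑ x : Cube N, (if ω x = false then dd x (FE κ δ) ω ^ k else 0)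
      ≤ 2 ^ N * (2 * (2 ^ 27 * Real.log N / δ ^ 8) ^ k) := by
  have hlog : 1 ≤ Real.log N := by nlinarith [sq_nonneg κ]
  have hN2 : (2 : ℝ) ≤ N := by
    have h0 : (0:ℝ) < N := by
      by_contra h
      have : (N : ℝ) = 0 := le_antisymm (not_lt.1 h) (Nat.cast_nonneg _)
      rw [this] at hlog; simp at hlog; linarith
    have := Real.log_le_sub_one_of_pos h0
    linarith
  set T := 2 ^ 27 * Real.log N / δ ^ 8 with hT
  have hT1 : 1 ≤ T := by
    rw [hT, le_div_iff₀ (by positivity)]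
    have : δ ^ 8 ≤ 1 := pow_le_one₀ hδ.le hδ1
    linarith
  have hTk : 1 ≤ T ^ k := one_le_pow₀ hT1
  by_cases hS : ((Sol κ ω).card : ℝ) < Real.exp (δ * N)
  · calc _ ≤ ∑ x : Cube N, (0:ℝ) := by
          apply Finset.sum_le_sum
          intro x _
          split_ifs with hx
          · rw [(drop κ hδ (by linarith : 0 ≤ T) ω x hx).2.2.1 hS]
            simp [hk0]
          · exact le_rfl
      _ = 0 := by simp
      _ ≤ _ := by positivity
  push Not at hS
  have hadd := add_one κ hN hδ hδ1 hbig hS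
  rw [bE_half, div_le_iff₀ (by positivity)] at hadd
  calc _ ≤ ∑ x : Cube N, (T ^ k + N ^ 2 * (if (((Sol κ ω).filter (fun y => y ∈ halfCube κ x)).card : ℝ)
          < Real.exp (-T) * (Sol κ ω).card then (1:ℝ) else 0)) := by
        apply Finset.sum_le_sum
        intro x _
        split_ifs with hx h h
        · have hd := drop κ hδ (by linarith : 0 ≤ T) ω x hx
          have : dd x (FE κ δ) ω ^ k ≤ (N:ℝ) ^ 2 :=
            (pow_le_pow_left₀ hd.1 hd.2.1 k).trans (pow_le_pow_right₀ (by linarith) hk)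
          linarith
        · have hd := drop κ hδ (by linarith : 0 ≤ T) ω x hx
          have := pow_le_pow_left₀ hd.1 (hd.2.2.2 (not_lt.1 h)) k
          linarith
        · positivity
        · positivity
    _ = 2 ^ N * T ^ k + N ^ 2 * ∑ x : Cube N, (if (((Sol κ ω).filter (fun y => y ∈ halfCube κ x)).card : ℝ)
          < Real.exp (-T) * (Sol κ ω).card then (1:ℝ) else 0) := by
        rw [Finset.sum_add_distrib, ← Finset.mul_sum, Finset.sum_const, nsmul_eq_mul, card_cube]
    _ ≤ 2 ^ N * T ^ k + N ^ 2 * (2 / (N : ℝ) ^ 4 * 2 ^ N) := by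
        gcongr
    _ ≤ _ := by
        have : (N : ℝ) ^ 2 * (2 / (N : ℝ) ^ 4) ≤ 1 := by
          have : (N : ℝ) ^ 2 * (2 / (N : ℝ) ^ 4) = 2 / (N : ℝ) ^ 2 := by field_simp
          rw [this, div_le_one (by positivity)]
          nlinarith
        have h2 : (0:ℝ) < 2 ^ N := by positivity
        nlinarith

lemma var_bound (κ : ℝ) {N : ℕ} (hN : κ ^ 2 + 1 ≤ Real.log N) {δ : ℝ} (hδ : 0 < δ) (hδ1 : δ ≤ 1)
    (hbig : 2 ^ 29 * Real.log N / δ ^ 10 ≤ N) {p : ℝ} (h0 : 0 ≤ p) (h1 : p ≤ 1) :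
    bE p (fun ω : Cube N → Bool => (FE κ δ ω - bE p (FE (N := N) κ δ)) ^ 2)
      ≤ p * 2 ^ N * (2 * (2 ^ 27 * Real.log N / δ ^ 8) ^ 2) := by
  have hes := efron_stein h0 h1 (FE (N := N) κ δ)
  set m := bE p (FE (N := N) κ δ) with hm
  have e1 : bE p (fun ω : Cube N → Bool => (FE κ δ ω - m) ^ 2)
      = bE p (fun ω : Cube N → Bool => FE κ δ ω ^ 2) - m ^ 2 := by
    have : (fun ω : Cube N → Bool => (FE κ δ ω - m) ^ 2)
        = fun ω => (FE κ δ ω ^ 2 - (2 * m) * FE κ δ ω) + m ^ 2 := by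
      ext ω; ring
    rw [this, bE_add, bE_sub, bE_mul_left, bE_const, ← hm]; ring
  rw [e1]
  refine hes.trans ?_
  have e2 : ∑ x : Cube N, p * (1 - p) * bE p (fun ω => dd x (FE κ δ) ω ^ 2)
      = p * bE p (fun ω => ∑ x : Cube N, (if ω x = false then dd x (FE κ δ) ω ^ 2 else 0)) := by
    rw [bE_sum, Finset.mul_sum]
    refine Finset.sum_congr rfl fun x _ => ?_
    rw [bE_dd_restrict p x (FE κ δ) (fun t => t ^ 2)]; ring
  rw [e2, mul_assoc]
  apply mul_le_mul_of_nonneg_left _ h0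
  rw [← bE_const (X := Cube N) p (2 ^ N * (2 * (2 ^ 27 * Real.log N / δ ^ 8) ^ 2))]
  exact bE_mono h0 h1 fun ω => sum_drop κ hN hδ hδ1 hbig 2 le_rfl two_ne_zero ω

lemma mean_bound (κ : ℝ) {N : ℕ} (hN : κ ^ 2 + 1 ≤ Real.log N) {δ : ℝ} (hδ : 0 < δ) (hδ1 : δ ≤ 1)
    (hbig : 2 ^ 29 * Real.log N / δ ^ 10 ≤ N) {p : ℝ} (h0 : 0 ≤ p) (h1 : p ≤ 1 / 2) :
    FE (N := N) κ δ (fun _ => false) - bE p (FE (N := N) κ δ)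
      ≤ p * 2 ^ N * (4 * (2 ^ 27 * Real.log N / δ ^ 8)) := by
  set T := 2 ^ 27 * Real.log N / δ ^ 8 with hT
  have hT0 : 0 ≤ T := by
    have : 0 ≤ Real.log N := Real.log_natCast_nonneg _
    positivity
  have hder : ∀ q, 0 < q → q < 1 / 2 → HasDerivAt (fun q => bE q (FE (N := N) κ δ))
      (- ∑ x, bE q (dd x (FE (N := N) κ δ))) q :=
    fun q hq0 hq1 => bE_hasDerivAt hq0 (by linarith) _
  have hbd : ∀ q, 0 < q → q < 1 / 2 → -(2 ^ N * (4 * T)) ≤ - ∑ x, bE q (dd x (FE (N := N) κ δ)) := by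
    intro q hq0 hq1
    apply neg_le_neg
    have e2 : (1 - q) * ∑ x : Cube N, bE q (fun ω => dd x (FE κ δ) ω)
        = bE q (fun ω => ∑ x : Cube N, (if ω x = false then dd x (FE κ δ) ω ^ 1 else 0)) := by
      rw [bE_sum, Finset.mul_sum]
      refine Finset.sum_congr rfl fun x _ => ?_
      rw [bE_dd_restrict q x (FE κ δ) (fun t => t ^ 1)]; simp
    have e3 : bE q (fun ω => ∑ x : Cube N, (if ω x = false then dd x (FE κ δ) ω ^ 1 else 0))
        ≤ 2 ^ N * (2 * T ^ 1) := by
      rw [← bE_const (X := Cube N) q (2 ^ N * (2 * T ^ 1))]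
      exact bE_mono hq0.le (by linarith) fun ω => sum_drop κ hN hδ hδ1 hbig 1 (by norm_num) one_ne_zero ω
    rw [← e2, pow_one] at e3
    by_contra hcon
    push Not at hcon
    have : 0 ≤ 2 ^ N * (4 * T) := by positivity
    have e4 : (1 / 2) * (2 ^ N * (4 * T)) < (1 - q) * ∑ x : Cube N, bE q (fun ω => dd x (FE κ δ) ω) :=
      calc (1 / 2) * (2 ^ N * (4 * T)) < (1 / 2) * ∑ x : Cube N, bE q (dd x (FE κ δ)) :=
            mul_lt_mul_of_pos_left hcon (by norm_num)
        _ ≤ _ := mul_le_mul_of_nonneg_right (by linarith) (by linarith)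
    linarith
  have hmv := Convex.mul_sub_le_image_sub_of_le_deriv (convex_Icc (0:ℝ) (1/2))
    (f := fun q => bE q (FE (N := N) κ δ)) (bE_continuous _).continuousOn
    (by
      rw [interior_Icc]
      intro q hq
      exact (hder q hq.1 hq.2).differentiableAt.differentiableWithinAt)
    (C := -(2 ^ N * (4 * T)))
    (by
      rw [interior_Icc]
      intro q hq
      rw [(hder q hq.1 hq.2).deriv]
      exact hbd q hq.1 hq.2)
    0 (by constructor <;> norm_num) p ⟨h0, h1⟩ h0
  rw [bE_zero] at hmv
  linarith

/-! ### Conclusion -/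

lemma prob_empty {N : ℕ} (κ p : ℝ) : bernoulliP p (emptyInter (N := N) κ)
    = bE p (fun ω : Cube N → Bool => if Sol κ ω = ∅ then 1 else 0) := by
  rw [bernoulliP_eq]
  congr 1
  ext ω
  by_cases h : Sol κ ω = ∅
  · rw [if_pos h, if_pos ((mem_emptyInter κ ω).2 h)]
  · rw [if_neg h, if_neg (fun h' => h ((mem_emptyInter κ ω).1 h'))]

lemma prob_nonempty {N : ℕ} (κ p : ℝ) :
    bE p (fun ω : Cube N → Bool => if (Sol κ ω).Nonempty then 1 else 0)
    = 1 - bernoulliP p (emptyInter (N := N) κ) := by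
  rw [prob_empty, ← bE_const (X := Cube N) p 1, ← bE_sub]
  congr 1
  ext ω
  by_cases h : Sol κ ω = ∅
  · simp [h, bE_const]
  · simp [h, Finset.nonempty_iff_ne_empty, bE_const]

lemma L_upper {N : ℕ} (hN1 : (1:ℝ) ≤ N) (κ : ℝ) {r p ε : ℝ} (h0 : 0 ≤ p) (h1 : p ≤ 1)
    (hr : ∀ y : Cube N, r * 2 ^ N ≤ ((Finset.univ.filter (fun x => y ∉ halfCube κ x)).card : ℝ))
    (hε : ε < 1 / 2) (hp : bernoulliP p (emptyInter (N := N) κ) = ε) :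
    r * (p * 2 ^ N) ≤ 2 * N := by
  have hk := kill κ h1 h0 Finset.univ hr
  rw [card_cube] at hk
  have hne := prob_nonempty (N := N) κ p
  rw [hp] at hne
  have h2 : bE p (fun ω : Cube N → Bool => if (Sol κ ω).Nonempty then (1:ℝ) else 0)
      ≤ 2 ^ N * Real.exp (-(p * (r * 2 ^ N))) := by
    refine le_trans ?_ hk
    apply bE_mono h0 h1
    intro ω
    by_cases h : (Sol κ ω).Nonempty
    · rw [if_pos h, if_pos]
      obtain ⟨y, hy⟩ := h
      exact ⟨y, Finset.mem_univ _, hy⟩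
    · rw [if_neg h]; split_ifs <;> norm_num
  have h3 : (1:ℝ) / 2 ≤ 2 ^ N * Real.exp (-(p * (r * 2 ^ N))) := by linarith
  have h4 := Real.log_le_log (by norm_num) h3
  rw [Real.log_mul (by positivity) (Real.exp_pos _).ne', Real.log_exp, Real.log_pow,
    one_div, Real.log_inv] at h4
  have := Real.log_two_lt_d9
  nlinarith

lemma FE_empty {N : ℕ} {κ δ : ℝ} (hδ : 0 ≤ δ) {ω : Cube N → Bool} (h : Sol κ ω = ∅) :
    FE κ δ ω = δ * N := by
  unfold FE
  rw [h]
  simp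
  positivity

lemma L_lower (κ : ℝ) {N : ℕ} (hN : κ ^ 2 + 1 ≤ Real.log N)
    (hbig : 2 ^ 29 * Real.log N / (1 / 4) ^ 10 ≤ N) {p ε : ℝ} (h0 : 0 ≤ p) (h1 : p ≤ 1 / 2)
    (hε : 0 ≤ ε)
    (hp : bernoulliP p (emptyInter (N := N) κ) = ε) :
    ε * N ≤ 2 ^ 47 * Real.log N * (p * 2 ^ N) := by
  have hm := mean_bound κ hN (by norm_num) (by norm_num : (1:ℝ)/4 ≤ 1) hbig h0 h1
  have hl := Real.log_two_gt_d9
  have hNn : (0:ℝ) ≤ N := Nat.cast_nonneg _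
  have hF0 : FE (N := N) κ (1/4) (fun _ => false) ≥ N * Real.log 2 := by
    have : Sol (N := N) κ (fun _ => false) = Finset.univ := by
      ext y; simp [mem_Sol]
    unfold FE
    rw [this, card_cube, Real.log_pow]
    exact le_max_left _ _
  have hE : bE p (FE (N := N) κ (1/4)) ≤ N * Real.log 2 - (N * Real.log 2 - 1/4 * N) * ε := by
    rw [← hp, prob_empty, ← bE_mul_left, ← bE_const (X := Cube N) p (N * Real.log 2), ← bE_sub]
    apply bE_mono h0 (by linarith)
    intro ω
    rw [bE_const]
    by_cases h : Sol κ ω = ∅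
    · rw [FE_empty (by norm_num) h, if_pos h]; linarith
    · rw [if_neg h, mul_zero, sub_zero]
      exact max_le (log_Sol_le κ ω) (by nlinarith)
  have e : p * 2 ^ N * (4 * (2 ^ 27 * Real.log N / (1 / 4) ^ 8))
      = 2 ^ 45 * (Real.log N * (p * 2 ^ N)) := by ring
  rw [e] at hm
  have h5 : (1 / 4) * (ε * N) ≤ (N * Real.log 2 - 1/4 * N) * ε := by
    have : 0 ≤ ε * N := by positivity
    nlinarith
  linarith

lemma sprinkle_step (κ : ℝ) {N : ℕ} {r p p' s t : ℝ} (h0 : 0 ≤ p) (h1 : p ≤ 1)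
    (s0 : 0 ≤ s) (s1 : s ≤ 1) (hs : 1 - p' = (1 - p) * (1 - s)) (ht : 0 ≤ t)
    (hr : ∀ y : Cube N, r * 2 ^ N ≤ ((Finset.univ.filter (fun x => y ∉ halfCube κ x)).card : ℝ)) :
    1 - bernoulliP p' (emptyInter (N := N) κ)
      ≤ bE p (fun ω : Cube N → Bool => if t < (Sol κ ω).card then 1 else 0)
        + t * Real.exp (-(s * (r * 2 ^ N))) := by
  rw [← prob_nonempty, bE_sprinkle hs, ← bE_const (X := Cube N) p (t * _), ← bE_add]
  apply bE_mono h0 h1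
  intro ω
  have hmono : ∀ σ : Cube N → Bool, (Sol κ (fun x => ω x || σ x)).Nonempty →
      ∃ y ∈ Sol κ ω, y ∈ Sol κ σ := by
    rintro σ ⟨y, hy⟩
    rw [mem_Sol] at hy
    refine ⟨y, mem_Sol.2 fun x hx => hy x (by simp [hx]), mem_Sol.2 fun x hx => hy x (by simp [hx])⟩
  have hle1 : bE s (fun σ : Cube N → Bool => if (Sol κ (fun x => ω x || σ x)).Nonempty then (1:ℝ) else 0)
      ≤ 1 := by
    conv_rhs => rw [← bE_const (X := Cube N) s 1]
    apply bE_mono s0 s1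
    intro σ
    split_ifs <;> norm_num
  have hle2 : bE s (fun σ : Cube N → Bool => if (Sol κ (fun x => ω x || σ x)).Nonempty then (1:ℝ) else 0)
      ≤ (Sol κ ω).card * Real.exp (-(s * (r * 2 ^ N))) := by
    refine le_trans ?_ (kill κ s1 s0 (Sol κ ω) hr)
    apply bE_mono s0 s1
    intro σ
    by_cases h : (Sol κ (fun x => ω x || σ x)).Nonempty
    · rw [if_pos h, if_pos (hmono σ h)]
    · rw [if_neg h]; split_ifs <;> norm_num
  by_cases h : t < (Sol κ ω).card
  · rw [if_pos h]
    have : 0 ≤ t * Real.exp (-(s * (r * 2 ^ N))) := by positivity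
    linarith
  · rw [if_neg h, zero_add]
    refine hle2.trans ?_
    exact mul_le_mul_of_nonneg_right (not_lt.1 h) (Real.exp_pos _).le

lemma var_lower {X : Type*} [Fintype X] [DecidableEq X] {p : ℝ} (h0 : 0 ≤ p) (h1 : p ≤ 1)
    (F : (X → Bool) → ℝ) (m : ℝ) {a c : ℝ} (ha : 0 ≤ a) (A B : (X → Bool) → Prop)
    [DecidablePred A] [DecidablePred B]
    (hA : ∀ ω, A ω → F ω ≤ a) (hB : ∀ ω, B ω → 2 * a ≤ F ω)
    (hcA : c ≤ bE p (fun ω => if A ω then 1 else 0))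
    (hcB : c ≤ bE p (fun ω => if B ω then 1 else 0)) :
    (a / 2) ^ 2 * c ≤ bE p (fun ω => (F ω - m) ^ 2) := by
  have key : ∀ (Q : (X → Bool) → Prop) [DecidablePred Q], (∀ ω, Q ω → (a / 2) ^ 2 ≤ (F ω - m) ^ 2) →
      c ≤ bE p (fun ω => if Q ω then 1 else 0) →
      (a / 2) ^ 2 * c ≤ bE p (fun ω => (F ω - m) ^ 2) := by
    intro Q _ hQ hc
    refine (mul_le_mul_of_nonneg_left hc (sq_nonneg _)).trans ?_
    rw [← bE_mul_left]
    apply bE_mono h0 h1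
    intro ω
    by_cases h : Q ω
    · rw [if_pos h, mul_one]; exact hQ ω h
    · rw [if_neg h, mul_zero]; positivity
  rcases le_total m (3 / 2 * a) with h | h
  · refine key B (fun ω hω => ?_) hcB
    have := hB ω hω
    exact pow_le_pow_left₀ (by linarith) (by linarith) 2
  · refine key A (fun ω hω => ?_) hcA
    have := hA ω hω
    have e : (F ω - m) ^ 2 = (m - F ω) ^ 2 := by ring
    rw [e]
    exact pow_le_pow_left₀ (by linarith) (by linarith) 2

set_option maxHeartbeats 2000000 in
lemma core (κ : ℝ) {N : ℕ} {r η ε p p' d0 : ℝ} (hN : κ ^ 2 + 1 ≤ Real.log N)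
    (hr0 : 0 < r) (hr1 : r ≤ 1)
    (hr : ∀ y : Cube N, r * 2 ^ N ≤ ((Finset.univ.filter (fun x => y ∉ halfCube κ x)).card : ℝ))
    (hη1 : η ≤ 1) (hηb : 1 / Real.log N ≤ η) (hεη : η ≤ ε) (hε : ε < 1 / 2)
    (h0 : 0 < p) (h1 : p < 1) (h1' : p' < 1)
    (hd0 : d0 = r / 2 ^ 50 / Real.log N ^ 3)
    (H0 : 4 * N / r ≤ 2 ^ N)
    (H1 : 2 ^ 29 * Real.log N / (1 / 4) ^ 10 ≤ N)
    (H2 : 2 ^ 29 * Real.log N / d0 ^ 10 ≤ N)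
    (H3 : 2 * Real.log N ≤ 6 * (d0 * N))
    (H4 : 2 ^ 59 * Real.log N ^ 2 < N * (1 / Real.log N) * d0 ^ 18 * r)
    (hp : bernoulliP p (emptyInter (N := N) κ) = ε)
    (hp' : bernoulliP p' (emptyInter (N := N) κ) = 1 - ε) :
    p' ≤ p * (1 + η) := by
  by_contra hcon
  push Not at hcon
  set b := Real.log N with hb
  have hb1 : 1 ≤ b := by nlinarith [sq_nonneg κ]
  have hNpos : (0:ℝ) < N := by
    by_contra h
    have : (N : ℝ) = 0 := le_antisymm (not_lt.1 h) (Nat.cast_nonneg _)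
    rw [hb, this] at hb1; simp at hb1; linarith
  have hN1 : (1:ℝ) ≤ N := by
    have := Real.log_le_sub_one_of_pos hNpos
    linarith
  have hη0 : 0 < η := lt_of_lt_of_le (by positivity) hηb
  have hε0 : 0 < ε := by linarith
  have h2N : (0:ℝ) < 2 ^ N := by positivity
  have hLu := L_upper hN1 κ h0.le h1.le hr hε hp
  have hphalf : p ≤ 1 / 2 := by
    rw [div_le_iff₀ hr0] at H0
    by_contra h
    push Not at h
    have : (1/2) * 2 ^ N * r < p * 2 ^ N * r := by gcongr
    linarith
  have hLl := L_lower κ hN H1 h0.le hphalf hε0.le hp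
  rw [← hb] at hLl
  set Lm := p * 2 ^ N with hLm
  have hLm0 : 0 < Lm := by positivity
  set δ := η * r * Lm / (8 * N) with hδdef
  have hδ0 : 0 < δ := by positivity
  have hδN : 8 * (δ * N) = η * (r * Lm) := by rw [hδdef]; field_simp
  have hδ1 : δ ≤ 1 := by
    rw [hδdef, div_le_one (by positivity)]
    nlinarith [mul_pos hr0 hLm0]
  have hδd : d0 ≤ δ := by
    have e1 : d0 * b ^ 3 = r / 2 ^ 50 := by rw [hd0]; field_simp
    have e2 : 1 ≤ η * b := by rwa [div_le_iff₀ (by linarith)] at hηb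
    have e3 : 1 ≤ ε * b := e2.trans (by gcongr)
    have e4 : ε * N * η * r ≤ 2 ^ 47 * b * Lm * η * r := by gcongr
    have e5 : 2 ^ 47 * b * Lm * η * r = 2 ^ 50 * b * (δ * N) := by
      have : 2 ^ 47 * b * Lm * η * r = 2 ^ 47 * b * (η * (r * Lm)) := by ring
      rw [this, ← hδN]; ring
    rw [e5] at e4
    have e6 : ε * η * r ≤ 2 ^ 50 * b * δ := by
      refine le_of_mul_le_mul_right (a := (N:ℝ)) ?_ hNpos
      linarith
    have e7 : r ≤ (2 ^ 50 * b ^ 3) * δ := by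
      have : 1 * 1 * r ≤ (ε * b) * (η * b) * r := by gcongr
      have : (ε * η * r) * b ^ 2 ≤ (2 ^ 50 * b * δ) * b ^ 2 := by gcongr
      linarith
    rw [hd0, div_div, div_le_iff₀ (by positivity)]
    linarith
  have hd00 : 0 < d0 := by rw [hd0]; positivity
  have hbig : 2 ^ 29 * b / δ ^ 10 ≤ N := by
    refine le_trans ?_ H2
    gcongr
  -- sprinkling
  set s := (p' - p) / (1 - p) with hs
  have h1p : 0 < 1 - p := by linarith
  have hpp : p * η ≤ p' - p := by linarith
  have hs0 : p * η ≤ s := by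
    rw [hs, le_div_iff₀ h1p]
    nlinarith [mul_pos h0 hη0]
  have hs00 : 0 ≤ s := le_trans (by positivity) hs0
  have hs1 : s ≤ 1 := by rw [hs, div_le_one h1p]; linarith
  have hseq : 1 - p' = (1 - p) * (1 - s) := by rw [hs]; field_simp; ring
  have hsp := sprinkle_step κ h0.le h1.le hs00 hs1 hseq (Real.exp_pos (2 * (δ * N))).le hr
  rw [hp', ← Real.exp_add] at hsp
  have hexp : Real.exp (2 * (δ * N) + -(s * (r * 2 ^ N))) ≤ ε / 2 := by
    have e1 : p * η * (r * 2 ^ N) ≤ s * (r * 2 ^ N) := by gcongr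
    have e2 : p * η * (r * 2 ^ N) = 8 * (δ * N) := by rw [hδN, hLm]; ring
    have e3 : 2 * b ≤ 6 * (δ * N) := H3.trans (by gcongr)
    calc _ ≤ Real.exp (-(2 * b)) := Real.exp_le_exp.2 (by linarith)
      _ = (Real.exp (2 * b))⁻¹ := Real.exp_neg _
      _ ≤ (2 * b)⁻¹ := by
          apply inv_anti₀ (by linarith)
          linarith [Real.add_one_le_exp (2 * b)]
      _ = (1 / b) / 2 := by field_simp
      _ ≤ ε / 2 := by linarith
  have hB : ε / 2 ≤ bE p (fun ω : Cube N → Bool =>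
      if Real.exp (2 * (δ * N)) < (Sol κ ω).card then (1:ℝ) else 0) := by linarith
  have hA : ε / 2 ≤ bE p (fun ω : Cube N → Bool => if Sol κ ω = ∅ then (1:ℝ) else 0) := by
    rw [← prob_empty, hp]; linarith
  have hvl := var_lower h0.le h1.le (FE (N := N) κ δ) (bE p (FE (N := N) κ δ)) (a := δ * N)
    (by positivity) _ _ (fun ω hω => (FE_empty hδ0.le hω).le)
    (fun ω hω => by
      have := Real.log_le_log (Real.exp_pos _) (le_of_lt hω)
      rw [Real.log_exp] at this
      exact this.trans (le_max_left _ _)) hA hB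
  have hvu := hvl.trans (var_bound κ hN hδ0 hδ1 hbig h0.le h1.le)
  rw [← hb, ← hLm] at hvu
  have f1 : (δ * N / 2) ^ 2 * (ε / 2) * δ ^ 16 * r
      ≤ Lm * (2 * (2 ^ 27 * b / δ ^ 8) ^ 2) * δ ^ 16 * r := by gcongr
  have f2 : Lm * (2 * (2 ^ 27 * b / δ ^ 8) ^ 2) * δ ^ 16 * r = 2 ^ 55 * b ^ 2 * (r * Lm) := by
    field_simp
  rw [f2] at f1
  have f3 : 2 ^ 55 * b ^ 2 * (r * Lm) ≤ 2 ^ 55 * b ^ 2 * (2 * N) := by gcongr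
  have f4 : (N * ε * δ ^ 18 * r) * N ≤ (2 ^ 59 * b ^ 2) * N := by
    have : (δ * N / 2) ^ 2 * (ε / 2) * δ ^ 16 * r = (N * ε * δ ^ 18 * r) * N / 8 := by ring
    linarith
  have f5 := le_of_mul_le_mul_right f4 hNpos
  have f6 : N * (1 / b) * d0 ^ 18 * r ≤ N * ε * δ ^ 18 * r := by
    have : 1 / b ≤ ε := by linarith
    gcongr
  linarith

lemma plog (K : ℝ) (hK : 0 < K) (k : ℕ) :
    ∀ᶠ N : ℕ in Filter.atTop, K * Real.log N ^ k ≤ N := by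
  have h := (Real.isLittleO_pow_log_id_atTop (n := k)).def (inv_pos.2 hK)
  have h2 := tendsto_natCast_atTop_atTop (R := ℝ) |>.eventually h
  filter_upwards [h2] with N hN
  simp only [id, Real.norm_eq_abs] at hN
  rw [abs_of_nonneg (Nat.cast_nonneg N : (0:ℝ) ≤ (N:ℝ))] at hN
  have h3 := (le_abs_self _).trans hN
  calc K * Real.log N ^ k ≤ K * (K⁻¹ * N) := mul_le_mul_of_nonneg_left h3 hK.le
    _ = N := by field_simp

/-- **Sharp threshold for the Ising perceptron.** For every `κ` and all `N`
sufficiently large, for every `ε` with `(log log N)^{-1/10} ≤ ε < 1/2`: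
if `ℙ_p(⋂ H(x) = ∅) = ε` and `ℙ_{p'}(⋂ H(x) = ∅) = 1 - ε`, then
`p' ≤ p (1 + (log log N)^{-1/10})`. -/
theorem ising_perceptron_sharp_threshold (κ : ℝ) :
    ∃ N₀ : ℕ, ∀ N : ℕ, N₀ ≤ N →
      ∀ ε p p' : ℝ,
        Real.log (Real.log N) ^ (-(1 : ℝ) / 10) ≤ ε → ε < 1 / 2 →
        0 < p → p < 1 → 0 < p' → p' < 1 →
        bernoulliP p (emptyInter (N := N) κ) = ε →
        bernoulliP p' (emptyInter (N := N) κ) = 1 - ε →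
        p' ≤ p * (1 + Real.log (Real.log N) ^ (-(1 : ℝ) / 10)) := by
  obtain ⟨r, hr0, hr1, N1, hr⟩ := fail_count κ
  set c := r / 2 ^ 50 with hc
  have hc0 : 0 < c := by positivity
  have hlogN : Filter.Tendsto (fun N : ℕ => Real.log N) Filter.atTop Filter.atTop :=
    Real.tendsto_log_atTop.comp tendsto_natCast_atTop_atTop
  have hloglogN : Filter.Tendsto (fun N : ℕ => Real.log (Real.log N)) Filter.atTop Filter.atTop :=
    Real.tendsto_log_atTop.comp hlogN
  have E0 : ∀ᶠ N : ℕ in Filter.atTop, (N:ℝ) ^ 1 / 2 ^ N < r / 4 :=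
    (tendsto_pow_const_div_const_pow_of_one_lt 1 (by norm_num : (1:ℝ) < 2)).eventually_lt_const
      (by positivity)
  have hall := (Filter.eventually_ge_atTop N1).and <| (hlogN.eventually_ge_atTop (κ ^ 2 + 1)).and <|
    (hloglogN.eventually_ge_atTop 1).and <| E0.and <|
    (plog (2 ^ 29 * 4 ^ 10) (by positivity) 1).and <|
    (plog (2 ^ 29 / c ^ 10) (by positivity) 31).and <|
    (plog (1 / (3 * c)) (by positivity) 4).and (plog (2 ^ 60 / (c ^ 18 * r)) (by positivity) 57)
  obtain ⟨N₀, hN₀⟩ := Filter.eventually_atTop.1 hall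
  refine ⟨N₀, fun N hN ε p p' hε1 hε2 h0 h1 h0' h1' hp hp' => ?_⟩
  obtain ⟨a1, a2, a3, a4, a5, a6, a7, a8⟩ := hN₀ N hN
  have hb1 : 1 ≤ Real.log N := by nlinarith [sq_nonneg κ]
  have hb0 : 0 < Real.log N := by linarith
  have hll : Real.log (Real.log N) ≤ Real.log N := by
    linarith [Real.log_le_sub_one_of_pos hb0]
  have hNn : (0:ℝ) ≤ N := Nat.cast_nonneg _
  refine core κ (d0 := c / Real.log N ^ 3) a2 hr0 hr1 (hr N a1) ?_ ?_ hε1 hε2 h0 h1 h1' (by rw [hc])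
    ?_ ?_ ?_ ?_ ?_ hp hp'
  · exact Real.rpow_le_one_of_one_le_of_nonpos a3 (by norm_num)
  · calc 1 / Real.log N ≤ 1 / Real.log (Real.log N) := by
          apply one_div_le_one_div_of_le _ hll
          linarith
      _ = Real.log (Real.log N) ^ (-1 : ℝ) := by rw [Real.rpow_neg_one, one_div]
      _ ≤ _ := Real.rpow_le_rpow_of_exponent_le a3 (by norm_num)
  · rw [pow_one, div_lt_iff₀ (by positivity)] at a4
    rw [div_le_iff₀ hr0]
    linarith
  · refine le_trans (le_of_eq ?_) a5
    ring
  · refine le_trans (le_of_eq ?_) a6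
    field_simp
  · have e : 6 * (c / Real.log N ^ 3 * N) = 6 * c / Real.log N ^ 3 * N := by ring
    rw [e]
    refine le_trans (le_of_eq ?_) (mul_le_mul_of_nonneg_left a7 (by positivity))
    field_simp
    norm_num
  · have e : N * (1 / Real.log N) * (c / Real.log N ^ 3) ^ 18 * r
        = (c ^ 18 * r / Real.log N ^ 55) * N := by
      field_simp
    rw [e]
    refine lt_of_lt_of_le ?_ (mul_le_mul_of_nonneg_left a8 (by positivity))
    have e2 : c ^ 18 * r / Real.log N ^ 55 * (2 ^ 60 / (c ^ 18 * r) * Real.log N ^ 57)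
        = 2 ^ 60 * Real.log N ^ 2 := by
      field_simp
    rw [e2]
    have : 0 < Real.log N ^ 2 := by positivity
    linarith
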